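/- Let W be a discrete memoryless channel with finite input alphabet X and finite output alphabet Y, and let ε ∈ (0,1) be such that the ε-channel dispersion V_ε of W is strictly positive. Then there exists a constant K ∈ ℝ such that for all n ≥ 1, log M*(W^n, ε) ≤ n·C + √(n·V_ε)·Φ⁻¹(ε) + (1/2)·log n + K, where C is the capacity of W. -/

import Mathlib

open Finset MeasureTheory

/-- `P` is a probability distribution on the finite set `Z`. -/
def IsDist {Z : Type*} [Fintype Z] (P : Z → ℝ) : Prop :=
  (∀ z, 0 ≤ P z) ∧ ∑ z, P z = 1

/-- `W` is a (discrete memoryless) channel from `X` to `Y`: a stochastic matrix. -/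
def IsChannel {X Y : Type*} [Fintype X] [Fintype Y] (W : X → Y → ℝ) : Prop :=
  ∀ x, IsDist (W x)

/-- Relative entropy `D(P‖Q) = Σ_z P(z) log (P(z)/Q(z))`. -/
noncomputable def relEnt {Z : Type*} [Fintype Z] (P Q : Z → ℝ) : ℝ :=
  ∑ z, P z * Real.log (P z / Q z)

/-- Divergence variance `V(P‖Q)`. -/
noncomputable def divVar {Z : Type*} [Fintype Z] (P Q : Z → ℝ) : ℝ :=
  ∑ z, P z * (Real.log (P z / Q z) - relEnt P Q) ^ 2

/-- Output distribution `PW`. -/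
noncomputable def outDist {X Y : Type*} [Fintype X] (P : X → ℝ) (W : X → Y → ℝ) (y : Y) : ℝ :=
  ∑ x, P x * W x y

/-- Mutual information `I(P,W) = Σ_x P(x) D(W(·|x)‖PW)`. -/
noncomputable def mutInfo {X Y : Type*} [Fintype X] [Fintype Y] (P : X → ℝ) (W : X → Y → ℝ) : ℝ :=
  ∑ x, P x * relEnt (W x) (outDist P W)

/-- Channel capacity `C = max_P I(P,W)`. -/
noncomputable def capacity {X Y : Type*} [Fintype X] [Fintype Y] (W : X → Y → ℝ) : ℝ :=
  sSup {c : ℝ | ∃ P : X → ℝ, IsDist P ∧ c = mutInfo P W}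

/-- `P` is a capacity-achieving input distribution (member of `Π`). -/
def isCAID {X Y : Type*} [Fintype X] [Fintype Y] (W : X → Y → ℝ) (P : X → ℝ) : Prop :=
  IsDist P ∧ mutInfo P W = capacity W

/-- Conditional information variance `V(P,W) = Σ_x P(x) V(W(·|x)‖PW)`. -/
noncomputable def infoVar {X Y : Type*} [Fintype X] [Fintype Y] (P : X → ℝ) (W : X → Y → ℝ) : ℝ :=
  ∑ x, P x * divVar (W x) (outDist P W)

/-- `V_min = min_{P ∈ Π} V(P,W)`. -/
noncomputable def Vmin {X Y : Type*} [Fintype X] [Fintype Y] (W : X → Y → ℝ) : ℝ :=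
  sInf {v : ℝ | ∃ P : X → ℝ, isCAID W P ∧ v = infoVar P W}

/-- `V_max = max_{P ∈ Π} V(P,W)`. -/
noncomputable def Vmax {X Y : Type*} [Fintype X] [Fintype Y] (W : X → Y → ℝ) : ℝ :=
  sSup {v : ℝ | ∃ P : X → ℝ, isCAID W P ∧ v = infoVar P W}

/-- The `ε`-channel dispersion `V_ε`. -/
noncomputable def Veps {X Y : Type*} [Fintype X] [Fintype Y] (W : X → Y → ℝ) (ε : ℝ) : ℝ :=
  if ε < 1/2 then Vmin W else Vmax W

/-- Average error probability of the code `(e, d)` with `M` messages for channel `V`. -/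
noncomputable def avgErr {A B : Type*} [Fintype B] {M : ℕ} (V : A → B → ℝ)
    (e : Fin M → A) (d : B → Fin M) : ℝ :=
  1 - (1 / (M : ℝ)) * ∑ m : Fin M, ∑ b ∈ Finset.univ.filter (fun b => d b = m), V (e m) b

/-- `M*(V,ε)`: the largest number of messages of a code with average error probability `≤ ε`. -/
noncomputable def Mstar {A B : Type*} [Fintype B] (V : A → B → ℝ) (ε : ℝ) : ℕ :=
  sSup {M : ℕ | ∃ e : Fin M → A, ∃ d : B → Fin M, avgErr V e d ≤ ε}

/-- Standard normal cumulative distribution function `Φ`. -/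
noncomputable def stdPhi (a : ℝ) : ℝ :=
  ∫ x in Set.Iic a, Real.exp (-(x ^ 2) / 2) / Real.sqrt (2 * Real.pi)

/-- `Φ⁻¹(ε) = sup {a | Φ(a) ≤ ε}`. -/
noncomputable def PhiInv (ε : ℝ) : ℝ :=
  sSup {a : ℝ | stdPhi a ≤ ε}

/-- Expectation of `F` under the product of the weights `p i`. -/
noncomputable def prodExp {ι Y : Type*} [Fintype ι] [DecidableEq ι] [Fintype Y]
    (p : ι → Y → ℝ) (F : (ι → Y) → ℝ) : ℝ :=
  ∑ y, (∏ i, p i (y i)) * F y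

section ProdExp

variable {ι Y : Type*} [Fintype ι] [DecidableEq ι] [Fintype Y] {p : ι → Y → ℝ}

lemma prodExp_add (F G : (ι → Y) → ℝ) :
    prodExp p (fun y => F y + G y) = prodExp p F + prodExp p G := by
  simp [prodExp, mul_add, Finset.sum_add_distrib]

lemma prodExp_sub (F G : (ι → Y) → ℝ) :
    prodExp p (fun y => F y - G y) = prodExp p F - prodExp p G := by
  simp [prodExp, mul_sub, Finset.sum_sub_distrib]

lemma prodExp_const_mul (c : ℝ) (F : (ι → Y) → ℝ) :
    prodExp p (fun y => c * F y) = c * prodExp p F := by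
  simp only [prodExp, Finset.mul_sum]
  exact Finset.sum_congr rfl fun y _ => by ring

lemma prodExp_sum {κ : Type*} (s : Finset κ) (F : κ → (ι → Y) → ℝ) :
    prodExp p (fun y => ∑ k ∈ s, F k y) = ∑ k ∈ s, prodExp p (F k) := by
  simp only [prodExp, Finset.mul_sum]
  exact Finset.sum_comm

lemma prodExp_mono (hp : ∀ i, IsDist (p i)) {F G : (ι → Y) → ℝ} (h : ∀ y, F y ≤ G y) :
    prodExp p F ≤ prodExp p G :=
  Finset.sum_le_sum fun y _ =>
    mul_le_mul_of_nonneg_left (h y) (Finset.prod_nonneg fun i _ => (hp i).1 _)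

lemma prodExp_prod (g : ι → Y → ℝ) :
    prodExp p (fun y => ∏ i, g i (y i)) = ∏ i, ∑ a, p i a * g i a := by
  simp only [prodExp, ← Finset.prod_mul_distrib]
  rw [Finset.prod_univ_sum, Fintype.piFinset_univ]

lemma prodExp_const (hp : ∀ i, IsDist (p i)) (c : ℝ) : prodExp p (fun _ => c) = c := by
  have h := prodExp_prod (p := p) (fun _ _ => 1)
  have h1 : ∀ i, ∑ a, p i a = 1 := fun i => (hp i).2
  have h2 := prodExp_const_mul (p := p) c (fun _ => 1)
  simp_all

lemma prodExp_abs_le (hp : ∀ i, IsDist (p i)) {F G : (ι → Y) → ℝ} (h : ∀ y, |F y| ≤ G y) :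
    |prodExp p F| ≤ prodExp p G := by
  rw [abs_le]
  constructor
  · have := prodExp_mono hp (F := fun y => (-1) * G y) (G := F)
      (fun y => by linarith [(abs_le.1 (h y)).1])
    rw [prodExp_const_mul] at this
    linarith
  · exact prodExp_mono hp fun y => (abs_le.1 (h y)).2

/-- A coordinate is independent of any function which does not depend on it. -/
lemma prodExp_mul_of_indep (hp : ∀ i, IsDist (p i)) (i : ι) (g : Y → ℝ) (F : (ι → Y) → ℝ)
    (hF : ∀ y a, F (Function.update y i a) = F y) :
    prodExp p (fun y => g (y i) * F y) = (∑ a, p i a * g a) * prodExp p F := by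
  have key : ∀ g : Y → ℝ, prodExp p (fun y => g (y i) * F y) = (∑ a, p i a * g a) *
      ∑ r : {j // j ≠ i} → Y, (∏ j : {j // j ≠ i}, p j (r j)) *
        ∑ a, p i a * F ((Equiv.funSplitAt i Y).symm (a, r)) := by
    intro g
    have hFc : ∀ (a b : Y) r, F ((Equiv.funSplitAt i Y).symm (a, r)) =
        F ((Equiv.funSplitAt i Y).symm (b, r)) := by
      intro a b r
      rw [← hF ((Equiv.funSplitAt i Y).symm (b, r)) a]
      congr 1
      ext j
      by_cases hj : j = i
      · subst hj; simp [Equiv.funSplitAt, Equiv.piSplitAt]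
      · simp [Equiv.funSplitAt, Equiv.piSplitAt, hj]
    rw [prodExp, ← (Equiv.funSplitAt i Y).symm.sum_comp, Fintype.sum_prod_type, Finset.sum_mul]
    refine Finset.sum_congr rfl fun a _ => ?_
    rw [Finset.mul_sum]
    refine Finset.sum_congr rfl fun r _ => ?_
    have h1 : ∑ b, p i b * F ((Equiv.funSplitAt i Y).symm (b, r)) =
        F ((Equiv.funSplitAt i Y).symm (a, r)) := by
      rw [Finset.sum_congr rfl fun b _ => by rw [hFc b a r], ← Finset.sum_mul, (hp i).2, one_mul]
    rw [h1, Fintype.prod_eq_mul_prod_subtype_ne _ i]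
    have h2 : (Equiv.funSplitAt i Y).symm (a, r) i = a := by
      simp [Equiv.funSplitAt, Equiv.piSplitAt]
    have h3 : ∀ j : {j // j ≠ i}, (Equiv.funSplitAt i Y).symm (a, r) j = r j := by
      intro j
      simp [Equiv.funSplitAt, Equiv.piSplitAt, j.2]
    simp only [h2, h3]
    ring
  have h1 := key (fun _ => 1)
  simp only [one_mul, mul_one, (hp i).2] at h1
  rw [key g, h1]

lemma prodExp_coord (hp : ∀ i, IsDist (p i)) (i : ι) (g : Y → ℝ) :
    prodExp p (fun y => g (y i)) = ∑ a, p i a * g a := by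
  simpa [prodExp_const hp] using prodExp_mul_of_indep hp i g (fun _ => 1) (fun _ _ => rfl)

lemma sum_sub_coord_update {Z : Type*} (ξ : ι → Z → ℝ) (i : ι) (y : ι → Z) (a : Z) :
    (∑ j, ξ j (Function.update y i a j)) - ξ i (Function.update y i a i) =
      (∑ j, ξ j (y j)) - ξ i (y i) := by
  rw [← Finset.add_sum_erase _ _ (Finset.mem_univ i),
    ← Finset.add_sum_erase (f := fun j => ξ j (y j)) _ (Finset.mem_univ i)]
  simp only [add_sub_cancel_left]
  refine Finset.sum_congr rfl fun j hj => ?_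
  rw [Function.update_of_ne (Finset.ne_of_mem_erase hj)]

/-- Independence of a coordinate from the sum of all the others. -/
lemma prodExp_mul_comp_sum_sub (hp : ∀ i, IsDist (p i)) (ξ : ι → Y → ℝ) (i : ι) (g : Y → ℝ)
    (f : ℝ → ℝ) :
    prodExp p (fun y => g (y i) * f ((∑ j, ξ j (y j)) - ξ i (y i))) =
      (∑ a, p i a * g a) * prodExp p (fun y => f ((∑ j, ξ j (y j)) - ξ i (y i))) :=
  prodExp_mul_of_indep hp i g _ fun y a => by rw [sum_sub_coord_update]

lemma prodExp_sum_sq (hp : ∀ i, IsDist (p i)) (ξ : ι → Y → ℝ)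
    (h0 : ∀ i, ∑ a, p i a * ξ i a = 0) :
    prodExp p (fun y => (∑ i, ξ i (y i)) ^ 2) = ∑ i, ∑ a, p i a * ξ i a ^ 2 := by
  have h1 : ∀ y : ι → Y, (∑ i, ξ i (y i)) ^ 2 =
      ∑ i, (ξ i (y i) * ((∑ j, ξ j (y j)) - ξ i (y i)) + ξ i (y i) ^ 2) := by
    intro y
    simp only [mul_sub, Finset.sum_add_distrib, Finset.sum_sub_distrib, ← Finset.sum_mul, pow_two]
    ring
  simp only [h1]
  rw [prodExp_sum]
  refine Finset.sum_congr rfl fun i _ => ?_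
  rw [prodExp_add, prodExp_mul_comp_sum_sub hp ξ i (ξ i) (fun x => x), h0, zero_mul, zero_add,
    prodExp_coord hp i (fun a => ξ i a ^ 2)]

/-- One-sided Chebyshev inequality for a sum of independent centred variables. -/
lemma prodExp_sum_le_ge (hp : ∀ i, IsDist (p i)) (ξ : ι → Y → ℝ)
    (h0 : ∀ i, ∑ a, p i a * ξ i a = 0) {t : ℝ} (ht : 0 < t) :
    1 - (∑ i, ∑ a, p i a * ξ i a ^ 2) / t ^ 2 ≤
      prodExp p (fun y => if ∑ i, ξ i (y i) ≤ t then 1 else 0) := by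
  have h1 := prodExp_mono hp (F := fun y => 1 - (1 / t ^ 2) * (∑ i, ξ i (y i)) ^ 2)
    (G := fun y => if ∑ i, ξ i (y i) ≤ t then 1 else 0) (fun y => by
      split_ifs with h
      · have : 0 ≤ (1 / t ^ 2) * (∑ i, ξ i (y i)) ^ 2 := by positivity
        linarith
      · have : 1 ≤ (1 / t ^ 2) * (∑ i, ξ i (y i)) ^ 2 := by
          rw [one_div_mul_eq_div, le_div_iff₀ (by positivity)]
          nlinarith
        linarith)
  rw [prodExp_sub, prodExp_const hp, prodExp_const_mul, prodExp_sum_sq hp ξ h0,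
    one_div_mul_eq_div] at h1
  exact h1

lemma prodExp_abs_sum_le (hp : ∀ i, IsDist (p i)) (ξ : ι → Y → ℝ)
    (h0 : ∀ i, ∑ a, p i a * ξ i a = 0) {c : ℝ} (hc : 0 < c)
    (h2 : ∑ i, ∑ a, p i a * ξ i a ^ 2 ≤ c ^ 2) :
    prodExp p (fun y => |∑ i, ξ i (y i)|) ≤ c := by
  have h1 := prodExp_mono hp (F := fun y => |∑ i, ξ i (y i)|)
    (G := fun y => c / 2 + (1 / (2 * c)) * (∑ i, ξ i (y i)) ^ 2) (fun y => by
      have h3 : 0 ≤ (1 / (2 * c)) * (|∑ i, ξ i (y i)| - c) ^ 2 := by positivity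
      have h4 : (1 / (2 * c)) * (|∑ i, ξ i (y i)| - c) ^ 2 =
          c / 2 + (1 / (2 * c)) * (∑ i, ξ i (y i)) ^ 2 - |∑ i, ξ i (y i)| := by
        rw [sub_sq, sq_abs]
        field_simp
        ring
      linarith)
  rw [prodExp_add, prodExp_const hp, prodExp_const_mul, prodExp_sum_sq hp ξ h0] at h1
  have h5 : (1 / (2 * c)) * (∑ i, ∑ a, p i a * ξ i a ^ 2) ≤ (1 / (2 * c)) * c ^ 2 := by gcongr
  have h6 : (1 / (2 * c)) * c ^ 2 = c / 2 := by field_simp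
  linarith

/-- Concentration of a normalized sum of bounded independent variables on short intervals. -/
lemma prodExp_sum_mem_Icc_le (hp : ∀ i, IsDist (p i)) (ξ : ι → Y → ℝ)
    (h0 : ∀ i, ∑ a, p i a * ξ i a = 0) {β : ℝ} (hβ : 0 < β) (hb : ∀ i a, |ξ i a| ≤ β)
    (h2 : ∑ i, ∑ a, p i a * ξ i a ^ 2 = 1) {a b : ℝ} (hab : a ≤ b) :
    prodExp p (fun y => if ∑ i, ξ i (y i) ∈ Set.Icc a b then 1 else 0) ≤
      (b - a) / 2 + 2 * β := by
  set f : ℝ → ℝ := fun w => max (a - β) (min (b + β) w) - (a + b) / 2 with hf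
  have hfb : ∀ w, |f w| ≤ (b - a) / 2 + β := by
    intro w
    rw [abs_le]
    constructor
    · have := le_max_left (a - β) (min (b + β) w)
      simp only [hf]; linarith
    · have : max (a - β) (min (b + β) w) ≤ b + β :=
        max_le (by linarith) (min_le_left _ _)
      simp only [hf]; linarith
  have hmono : Monotone f := by
    intro u v huv
    simp only [hf]
    gcongr
  have hfin : ∀ w, a - β ≤ w → w ≤ b + β → f w = w - (a + b) / 2 := by
    intro w h1 h2
    simp only [hf]
    rw [min_eq_right h2, max_eq_right h1]
  have hmulnn : ∀ w u, 0 ≤ u * (f w - f (w - u)) := by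
    intro w u
    rcases le_total 0 u with hu | hu
    · exact mul_nonneg hu (sub_nonneg.2 (hmono (by linarith)))
    · exact mul_nonneg_of_nonpos_of_nonpos hu (sub_nonpos.2 (hmono (by linarith)))
  set T : (ι → Y) → ℝ := fun y => ∑ i, ξ i (y i) with hT
  set η : ι → Y → ℝ := fun i c => ξ i c ^ 2 - ∑ a, p i a * ξ i a ^ 2 with hη
  have hη0 : ∀ i, ∑ a, p i a * η i a = 0 := by
    intro i
    simp only [hη, mul_sub, Finset.sum_sub_distrib, ← Finset.sum_mul, (hp i).2]
    ring
  have hη2 : ∑ i, ∑ a, p i a * η i a ^ 2 ≤ β ^ 2 := by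
    calc ∑ i, ∑ a, p i a * η i a ^ 2 ≤ ∑ i, β ^ 2 * ∑ a, p i a * ξ i a ^ 2 := by
          refine Finset.sum_le_sum fun i _ => ?_
          set m := ∑ a, p i a * ξ i a ^ 2 with hm
          have e1 : ∑ a, p i a * η i a ^ 2 = ∑ a, p i a * (ξ i a ^ 2 * ξ i a ^ 2) - m ^ 2 := by
            have : ∀ a, p i a * η i a ^ 2 = p i a * (ξ i a ^ 2 * ξ i a ^ 2)
                - 2 * m * (p i a * ξ i a ^ 2) + m ^ 2 * p i a := fun a => by
              simp only [hη]; ring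
            simp only [this, Finset.sum_add_distrib, Finset.sum_sub_distrib, ← Finset.mul_sum,
              (hp i).2, ← hm]
            ring
          have e2 : ∑ a, p i a * (ξ i a ^ 2 * ξ i a ^ 2) ≤ β ^ 2 * m := by
            rw [hm, Finset.mul_sum]
            refine Finset.sum_le_sum fun a _ => ?_
            have h3 : ξ i a ^ 2 ≤ β ^ 2 := sq_le_sq' (abs_le.1 (hb i a)).1 (abs_le.1 (hb i a)).2
            have h4 : 0 ≤ p i a * ξ i a ^ 2 := mul_nonneg ((hp i).1 a) (sq_nonneg _)
            nlinarith
          nlinarith [sq_nonneg m]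
      _ = β ^ 2 := by rw [← Finset.mul_sum, h2, mul_one]
  have hE1 : prodExp p (fun y => T y * f (T y)) ≤ (b - a) / 2 + β := by
    have h3 := prodExp_mono hp (F := fun y => T y * f (T y))
      (G := fun y => ((b - a) / 2 + β) * |T y|) (fun y => by
        calc T y * f (T y) ≤ |T y * f (T y)| := le_abs_self _
          _ = |f (T y)| * |T y| := by rw [abs_mul, mul_comm]
          _ ≤ _ := by gcongr; exact hfb _)
    rw [prodExp_const_mul] at h3
    have h4 : prodExp p (fun y => |T y|) ≤ 1 :=
      prodExp_abs_sum_le hp ξ h0 one_pos (by rw [h2]; norm_num)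
    nlinarith
  have hE2 : prodExp p (fun y => T y * f (T y)) =
      prodExp p (fun y => ∑ i, ξ i (y i) * (f (T y) - f (T y - ξ i (y i)))) := by
    have h3 : ∀ y, T y * f (T y) = ∑ i, (ξ i (y i) * (f (T y) - f (T y - ξ i (y i)))
        + ξ i (y i) * f (T y - ξ i (y i))) := by
      intro y
      rw [hT, Finset.sum_mul]
      exact Finset.sum_congr rfl fun i _ => by ring
    simp only [h3]
    rw [prodExp_sum, prodExp_sum]
    refine Finset.sum_congr rfl fun i _ => ?_
    rw [prodExp_add, prodExp_mul_comp_sum_sub hp ξ i (ξ i) f, h0, zero_mul, add_zero]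
  have hE3 : prodExp p (fun y => (if T y ∈ Set.Icc a b then 1 else 0) - |∑ i, η i (y i)|) ≤
      prodExp p (fun y => ∑ i, ξ i (y i) * (f (T y) - f (T y - ξ i (y i)))) := by
    refine prodExp_mono hp fun y => ?_
    split_ifs with h
    · have h3 : ∀ i, ξ i (y i) * (f (T y) - f (T y - ξ i (y i))) = ξ i (y i) ^ 2 := by
        intro i
        have h4 := abs_le.1 (hb i (y i))
        rw [hfin _ (by linarith [h.1]) (by linarith [h.2]),
          hfin _ (by linarith [h.1]) (by linarith [h.2])]
        ring
      have h5 : ∑ i, η i (y i) = ∑ i, ξ i (y i) ^ 2 - 1 := by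
        simp only [hη, Finset.sum_sub_distrib, h2]
      simp only [h3]
      rw [h5]
      linarith [neg_abs_le (∑ i, ξ i (y i) ^ 2 - 1)]
    · have h3 : 0 ≤ ∑ i, ξ i (y i) * (f (T y) - f (T y - ξ i (y i))) :=
        Finset.sum_nonneg fun i _ => hmulnn _ _
      linarith [abs_nonneg (∑ i, η i (y i))]
  rw [prodExp_sub] at hE3
  have := prodExp_abs_sum_le hp η hη0 hβ hη2
  linarith

end ProdExp

/-- The unnormalized Gaussian density. -/
noncomputable def gaussWeight (x : ℝ) : ℝ := Real.exp (-(x ^ 2) / 2)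

lemma gaussWeight_eq (x : ℝ) : gaussWeight x = Real.exp (-(1 / 2) * x ^ 2) := by
  rw [gaussWeight]; ring_nf

lemma gaussWeight_pos (x : ℝ) : 0 < gaussWeight x := Real.exp_pos _

lemma continuous_gaussWeight : Continuous gaussWeight := by
  unfold gaussWeight; fun_prop

lemma integrable_gaussWeight : Integrable gaussWeight := by
  simp_rw [funext gaussWeight_eq]
  exact integrable_exp_neg_mul_sq (by norm_num)

lemma integral_gaussWeight : ∫ x, gaussWeight x = Real.sqrt (2 * Real.pi) := by
  simp_rw [gaussWeight_eq]
  rw [integral_gaussian]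
  congr 1
  ring

lemma integrable_mul_gaussWeight : Integrable (fun x => x * gaussWeight x) := by
  simp_rw [gaussWeight_eq]
  exact integrable_mul_exp_neg_mul_sq (by norm_num)

lemma hasDerivAt_gaussWeight (x : ℝ) : HasDerivAt gaussWeight (-(x * gaussWeight x)) x := by
  have h : HasDerivAt (fun x : ℝ => -(x ^ 2) / 2) (-x) x := by
    exact (((hasDerivAt_pow 2 x).neg).div_const 2).congr_deriv (by norm_num; ring)
  exact h.exp.congr_deriv (by rw [gaussWeight]; ring)

lemma tendsto_gaussWeight_cocompact :
    Filter.Tendsto gaussWeight (Filter.cocompact ℝ) (nhds 0) := by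
  have := tendsto_rpow_abs_mul_exp_neg_mul_sq_cocompact (a := 1 / 2) (by norm_num) 0
  simpa [funext gaussWeight_eq] using this

lemma integral_Iic_neg_mul_gaussWeight (w : ℝ) :
    ∫ x in Set.Iic w, -(x * gaussWeight x) = gaussWeight w := by
  rw [integral_Iic_of_hasDerivAt_of_tendsto' (fun x _ => hasDerivAt_gaussWeight x)
    integrable_mul_gaussWeight.neg.integrableOn
    (tendsto_gaussWeight_cocompact.mono_left atBot_le_cocompact), sub_zero]

lemma integral_Ioi_mul_gaussWeight (w : ℝ) :
    ∫ x in Set.Ioi w, x * gaussWeight x = gaussWeight w := by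
  have := integral_Ioi_of_hasDerivAt_of_tendsto' (a := w)
    (fun x _ => hasDerivAt_gaussWeight x)
    integrable_mul_gaussWeight.neg.integrableOn
    (tendsto_gaussWeight_cocompact.mono_left atTop_le_cocompact)
  rw [integral_neg] at this
  linarith

/-- Mills ratio bound for the primitive of a centred function dominated by the Gaussian weight. -/
lemma abs_mul_integral_Iic_le {k : ℝ → ℝ} (hk : Integrable k) (h0 : ∫ x, k x = 0)
    (hb : ∀ x, |k x| ≤ gaussWeight x) (w : ℝ) :
    |w * ∫ x in Set.Iic w, k x| ≤ gaussWeight w := by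
  rcases le_total w 0 with hw | hw
  · rw [← integral_Iic_neg_mul_gaussWeight w, ← integral_const_mul]
    refine norm_integral_le_of_norm_le (f := fun x => w * k x)
      integrable_mul_gaussWeight.neg.integrableOn ?_
    refine (ae_restrict_mem measurableSet_Iic).mono fun x hx => ?_
    rw [Real.norm_eq_abs, abs_mul, abs_of_nonpos hw]
    have hx' : x ≤ w := hx
    calc -w * |k x| ≤ -x * gaussWeight x := by
          apply mul_le_mul (by linarith) (hb x) (abs_nonneg _) (by linarith)
      _ = _ := by ring
  · have h1 : ∫ x in Set.Iic w, k x = -∫ x in Set.Ioi w, k x := by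
      have := integral_add_compl (s := Set.Iic w) measurableSet_Iic hk
      rw [Set.compl_Iic, h0] at this
      linarith
    rw [h1, mul_neg, abs_neg, ← integral_Ioi_mul_gaussWeight w, ← integral_const_mul]
    refine norm_integral_le_of_norm_le (f := fun x => w * k x)
      integrable_mul_gaussWeight.integrableOn ?_
    refine (ae_restrict_mem measurableSet_Ioi).mono fun x hx => ?_
    rw [Real.norm_eq_abs, abs_mul, abs_of_nonneg hw]
    have hx' : w < x := hx
    exact mul_le_mul hx'.le (hb x) (abs_nonneg _) (by linarith)

lemma hasDerivAt_integral_Iic {k : ℝ → ℝ} (hk : Integrable k) (hc : Continuous k) (w : ℝ) :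
    HasDerivAt (fun w => ∫ x in Set.Iic w, k x) (k w) w := by
  have h1 : (fun w => ∫ x in Set.Iic w, k x) =
      fun w => (∫ x in Set.Iic (0 : ℝ), k x) + ∫ x in (0 : ℝ)..w, k x := by
    ext w
    have := intervalIntegral.integral_Iic_sub_Iic (f := k) (μ := volume) (a := 0) (b := w)
      hk.integrableOn hk.integrableOn
    linarith
  rw [h1]
  exact (intervalIntegral.integral_hasDerivAt_right hk.intervalIntegrable
    (hc.stronglyMeasurableAtFilter _ _) hc.continuousAt).const_add _

/-- A bounded solution of Stein's equation with bounded derivative. -/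
lemma exists_stein_solution {h : ℝ → ℝ} (hc : Continuous h) (h0 : ∀ x, 0 ≤ h x)
    (h1 : ∀ x, h x ≤ 1) :
    ∃ f f' : ℝ → ℝ, (∀ w, HasDerivAt f (f' w) w) ∧
      (∀ w, f' w = w * f w + h w - ∫ x, h x * (gaussWeight x / Real.sqrt (2 * Real.pi))) ∧
      (∀ w, |f w| ≤ 5) ∧ ∀ w, |f' w| ≤ 2 := by
  set m := ∫ x, h x * (gaussWeight x / Real.sqrt (2 * Real.pi)) with hm
  have hs : 0 < Real.sqrt (2 * Real.pi) := by positivity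
  have hint : Integrable (fun x => h x * gaussWeight x) := by
    refine integrable_gaussWeight.mono' (hc.mul continuous_gaussWeight).aestronglyMeasurable
      (Filter.Eventually.of_forall fun x => ?_)
    rw [Real.norm_eq_abs, abs_mul, abs_of_nonneg (h0 x), abs_of_pos (gaussWeight_pos x)]
    exact mul_le_of_le_one_left (gaussWeight_pos x).le (h1 x)
  have hm' : m * Real.sqrt (2 * Real.pi) = ∫ x, h x * gaussWeight x := by
    rw [hm, ← integral_mul_const]
    congr 1
    ext x
    field_simp
  have hm0 : 0 ≤ m := integral_nonneg fun x =>
    mul_nonneg (h0 x) (div_nonneg (gaussWeight_pos x).le hs.le)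
  have hm1 : m ≤ 1 := by
    have : m * Real.sqrt (2 * Real.pi) ≤ 1 * Real.sqrt (2 * Real.pi) := by
      rw [hm', one_mul, ← integral_gaussWeight]
      exact integral_mono hint integrable_gaussWeight fun x =>
        mul_le_of_le_one_left (gaussWeight_pos x).le (h1 x)
    exact le_of_mul_le_mul_right this hs
  have hd : ∀ x, |h x - m| ≤ 1 := fun x => by
    rw [abs_le]; constructor <;> linarith [h0 x, h1 x]
  set k : ℝ → ℝ := fun x => (h x - m) * gaussWeight x with hk
  have hkc : Continuous k := (hc.sub continuous_const).mul continuous_gaussWeight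
  have hki : Integrable k := by
    simp only [hk, sub_mul]
    exact hint.sub (integrable_gaussWeight.const_mul m)
  have hk0 : ∫ x, k x = 0 := by
    simp only [hk, sub_mul]
    rw [integral_sub hint (integrable_gaussWeight.const_mul m), integral_const_mul,
      integral_gaussWeight, hm']
    ring
  have hkb : ∀ x, |k x| ≤ gaussWeight x := fun x => by
    rw [abs_mul, abs_of_pos (gaussWeight_pos x)]
    exact mul_le_of_le_one_left (gaussWeight_pos x).le (hd x)
  have hinv : ∀ w, Real.exp (w ^ 2 / 2) * gaussWeight w = 1 := fun w => by
    rw [gaussWeight, ← Real.exp_add]; ring_nf; simp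
  set f : ℝ → ℝ := fun w => Real.exp (w ^ 2 / 2) * ∫ x in Set.Iic w, k x with hf
  have hwf : ∀ w, |w * f w| ≤ 1 := by
    intro w
    have e : w * f w = Real.exp (w ^ 2 / 2) * (w * ∫ x in Set.Iic w, k x) := by
      simp only [hf]; ring
    rw [e, abs_mul, abs_of_pos (Real.exp_pos _), ← hinv w]
    gcongr
    exact abs_mul_integral_Iic_le hki hk0 hkb w
  have hder : ∀ w, HasDerivAt f (w * f w + h w - m) w := by
    intro w
    have e1 : HasDerivAt (fun w : ℝ => Real.exp (w ^ 2 / 2)) (Real.exp (w ^ 2 / 2) * w) w :=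
      (((hasDerivAt_pow 2 w)).div_const 2).exp.congr_deriv (by simp)
    refine (e1.mul (hasDerivAt_integral_Iic hki hkc w)).congr_deriv ?_
    have : Real.exp (w ^ 2 / 2) * k w = h w - m := by
      simp only [hk]
      rw [mul_left_comm, hinv, mul_one]
    rw [this]
    simp only [hf]
    ring
  have hf' : ∀ w, |w * f w + h w - m| ≤ 2 := fun w => by
    rw [add_sub_assoc]
    exact (abs_add_le _ _).trans (by linarith [hwf w, hd w])
  refine ⟨f, fun w => w * f w + h w - m, hder, fun _ => rfl, fun w => ?_, hf'⟩
  rcases le_total 1 |w| with hw | hw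
  · have := hwf w
    rw [abs_mul] at this
    nlinarith [abs_nonneg (f w)]
  · have h3 : ‖f w - f 1‖ ≤ 2 * ‖w - 1‖ :=
      convex_univ.norm_image_sub_le_of_norm_hasDerivWithin_le
        (fun x _ => (hder x).hasDerivWithinAt) (fun x _ => hf' x) trivial trivial
    rw [Real.norm_eq_abs, Real.norm_eq_abs] at h3
    have h4 : |w - 1| ≤ 2 := by
      rw [abs_le] at hw ⊢; constructor <;> linarith
    have h5 : |f 1| ≤ 1 := by simpa using hwf 1
    have h6 : |f w| ≤ |f w - f 1| + |f 1| := by simpa using abs_add_le (f w - f 1) (f 1)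
    linarith

/-- One-sided Berry–Esseen bound for bounded independent variables. -/
theorem berry_esseen_prodExp {ι Y : Type*} [Fintype ι] [DecidableEq ι] [Fintype Y]
    {p : ι → Y → ℝ} (hp : ∀ i, IsDist (p i)) (ξ : ι → Y → ℝ)
    (hmean : ∀ i, ∑ a, p i a * ξ i a = 0) {β : ℝ} (hβ : 0 < β) (hβ1 : β ≤ 1)
    (hb : ∀ i a, |ξ i a| ≤ β) (hvar : ∑ i, ∑ a, p i a * ξ i a ^ 2 = 1) (z : ℝ) :
    stdPhi z - 28 * β ≤ prodExp p (fun y => if ∑ i, ξ i (y i) ≤ z + β then 1 else 0) := by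
  set h : ℝ → ℝ := fun w => max 0 (min 1 (1 + (z - w) / β)) with hh
  have hc : Continuous h := by fun_prop
  have h0 : ∀ x, 0 ≤ h x := fun x => le_max_left _ _
  have h1 : ∀ x, h x ≤ 1 := fun x => max_le zero_le_one (min_le_left _ _)
  have hleft : ∀ x, x ≤ z → h x = 1 := by
    intro x hx
    have : 0 ≤ (z - x) / β := div_nonneg (by linarith) hβ.le
    simp only [hh]
    rw [min_eq_left (by linarith), max_eq_right zero_le_one]
  have hright : ∀ x, z + β ≤ x → h x = 0 := by
    intro x hx
    have : (z - x) / β ≤ -1 := by rw [div_le_iff₀ hβ]; linarith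
    simp only [hh]
    exact max_eq_left ((min_le_right _ _).trans (by linarith))
  obtain ⟨f, f', hder, hstein, hfb, hfb'⟩ := exists_stein_solution hc h0 h1
  set m := ∫ x, h x * (gaussWeight x / Real.sqrt (2 * Real.pi)) with hm
  have hgi : Integrable (fun x => gaussWeight x / Real.sqrt (2 * Real.pi)) :=
    integrable_gaussWeight.div_const _
  have hgp : ∀ x, 0 ≤ gaussWeight x / Real.sqrt (2 * Real.pi) := fun x =>
    div_nonneg (gaussWeight_pos x).le (Real.sqrt_nonneg _)
  have hΦm : stdPhi z ≤ m := by
    rw [stdPhi, ← integral_indicator measurableSet_Iic, hm]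
    refine integral_mono (hgi.indicator measurableSet_Iic) ?_ fun x => ?_
    · refine hgi.mono' (hc.mul (continuous_gaussWeight.div_const _)).aestronglyMeasurable
        (Filter.Eventually.of_forall fun x => ?_)
      rw [Real.norm_eq_abs, abs_mul, abs_of_nonneg (h0 x), abs_of_nonneg (hgp x)]
      exact mul_le_of_le_one_left (hgp x) (h1 x)
    · by_cases hx : x ≤ z
      · simp only [Set.indicator, Set.mem_Iic, hx, if_true, hleft x hx, one_mul]
        exact le_rfl
      · simp only [Set.indicator, Set.mem_Iic, hx, if_false]
        exact mul_nonneg (h0 x) (hgp x)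
  set J : ℝ → ℝ := fun w => if w ∈ Set.Icc (z - β) (z + 2 * β) then 1 else 0 with hJ
  have hJ0 : ∀ w, 0 ≤ J w := fun w => by simp only [hJ]; split_ifs <;> norm_num
  have hflip : ∀ w v, |f w - f v| ≤ 2 * |w - v| := fun w v =>
    convex_univ.norm_image_sub_le_of_norm_hasDerivWithin_le
      (fun x _ => (hder x).hasDerivWithinAt) (fun x _ => hfb' x) trivial trivial
  set R : ℝ → ℝ := fun w => β * (5 + 2 * |w|) + J w with hR
  have hinc : ∀ w u, |u| ≤ β → |f' (w + u) - f' w| ≤ R w := by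
    intro w u hu
    have e : f' (w + u) - f' w =
        (u * f (w + u) + w * (f (w + u) - f w)) + (h (w + u) - h w) := by
      rw [hstein, hstein]; ring
    have e1 : |u * f (w + u)| ≤ β * 5 := by
      rw [abs_mul]; exact mul_le_mul hu (hfb _) (abs_nonneg _) hβ.le
    have e2 : |w * (f (w + u) - f w)| ≤ |w| * (2 * β) := by
      rw [abs_mul]
      gcongr
      have := hflip (w + u) w
      rw [add_sub_cancel_left] at this
      linarith
    have hu' := abs_le.1 hu
    have e3 : |h (w + u) - h w| ≤ J w := by
      by_cases hw : w ∈ Set.Icc (z - β) (z + 2 * β)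
      · simp only [hJ, hw, if_true]
        rw [abs_le]
        constructor <;> linarith [h0 w, h1 w, h0 (w + u), h1 (w + u)]
      · simp only [hJ, hw, if_false]
        rw [Set.mem_Icc, not_and_or, not_le, not_le] at hw
        rcases hw with hw | hw
        · rw [hleft w (by linarith), hleft (w + u) (by linarith)]; simp
        · rw [hright w (by linarith), hright (w + u) (by linarith)]; simp
    rw [e]
    refine (abs_add_le _ _).trans ?_
    have := abs_add_le (u * f (w + u)) (w * (f (w + u) - f w))
    simp only [hR]
    linarith
  have htaylor : ∀ w u, |u| ≤ β → |f (w + u) - f w - u * f' w| ≤ |u| * R w := by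
    intro w u hu
    have hd : ∀ x ∈ Set.Icc (-β) β, HasDerivWithinAt (fun x => f (w + x) - x * f' w)
        (f' (w + x) - f' w) (Set.Icc (-β) β) x := by
      intro x _
      have e1 : HasDerivAt (fun x => f (w + x)) (f' (w + x)) x :=
        (hder (w + x)).comp_const_add w x
      have e2 : HasDerivAt (fun x => x * f' w) (f' w) x := by
        simpa using (hasDerivAt_id x).mul_const (f' w)
      exact (e1.sub e2).hasDerivWithinAt
    have := (convex_Icc (-β) β).norm_image_sub_le_of_norm_hasDerivWithin_le hd
      (fun x hx => hinc w x (abs_le.2 hx)) (x := 0) (y := u)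
      ⟨by linarith, hβ.le⟩ (abs_le.1 hu)
    simp only [add_zero, zero_mul, sub_zero, Real.norm_eq_abs] at this
    calc |f (w + u) - f w - u * f' w| = |f (w + u) - u * f' w - f w| := by ring_nf
      _ ≤ _ := by linarith
  set T : (ι → Y) → ℝ := fun y => ∑ i, ξ i (y i) with hT
  set r := prodExp p (fun y => β * (7 + 2 * |T y|)
      + if T y ∈ Set.Icc (z - 2 * β) (z + 3 * β) then 1 else 0) with hr
  have hr14 : r ≤ 14 * β := by
    have e1 := prodExp_abs_sum_le hp ξ hmean one_pos (by rw [hvar]; norm_num)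
    have e2 := prodExp_sum_mem_Icc_le hp ξ hmean hβ hb hvar
      (show z - 2 * β ≤ z + 3 * β by linarith)
    rw [hr, prodExp_add, prodExp_const_mul, prodExp_add, prodExp_const_mul, prodExp_const hp]
    nlinarith
  have hRi : ∀ i, prodExp p (fun y => R (T y - ξ i (y i))) ≤ r := by
    intro i
    refine prodExp_mono hp fun y => ?_
    have hxi := hb i (y i)
    have hxi' := abs_le.1 hxi
    have e1 : |T y - ξ i (y i)| ≤ |T y| + 1 :=
      (abs_sub _ _).trans (by linarith)
    have e2 : J (T y - ξ i (y i)) ≤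
        if T y ∈ Set.Icc (z - 2 * β) (z + 3 * β) then 1 else 0 := by
      simp only [hJ]
      split_ifs with g1 g2
      · exact le_rfl
      · exact absurd ⟨by linarith [g1.1], by linarith [g1.2]⟩ g2
      · norm_num
      · exact le_rfl
    simp only [hR]
    nlinarith
  have hmain : |prodExp p (fun y => T y * f (T y)) - prodExp p (fun y => f' (T y))| ≤ 2 * r := by
    set v : ι → ℝ := fun i => ∑ a, p i a * ξ i a ^ 2 with hv
    have hv0 : ∀ i, 0 ≤ v i := fun i =>
      Finset.sum_nonneg fun a _ => mul_nonneg ((hp i).1 a) (sq_nonneg _)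
    have e1 : prodExp p (fun y => T y * f (T y)) =
        ∑ i, prodExp p (fun y => ξ i (y i) * f (T y)) := by
      rw [← prodExp_sum]
      congr 1
      ext y
      rw [hT, Finset.sum_mul]
    have e2 : prodExp p (fun y => f' (T y)) = ∑ i, v i * prodExp p (fun y => f' (T y)) := by
      rw [← Finset.sum_mul, hvar, one_mul]
    have e3 : ∀ i, |prodExp p (fun y => ξ i (y i) * f (T y))
        - v i * prodExp p (fun y => f' (T y - ξ i (y i)))| ≤ v i * r := by
      intro i
      have d1 := prodExp_mul_comp_sum_sub hp ξ i (ξ i) f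
      rw [hmean, zero_mul] at d1
      have d2 := prodExp_mul_comp_sum_sub hp ξ i (fun a => ξ i a ^ 2) f'
      have d3 := prodExp_mul_comp_sum_sub hp ξ i (fun a => ξ i a ^ 2) R
      have d4 : prodExp p (fun y => ξ i (y i) * f (T y))
          - v i * prodExp p (fun y => f' (T y - ξ i (y i))) =
          prodExp p (fun y => ξ i (y i) * f (T y) - ξ i (y i) * f (T y - ξ i (y i))
            - ξ i (y i) ^ 2 * f' (T y - ξ i (y i))) := by
        rw [prodExp_sub, prodExp_sub, d1, d2, sub_zero]
      rw [d4]
      calc _ ≤ prodExp p (fun y => ξ i (y i) ^ 2 * R (T y - ξ i (y i))) := by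
            refine prodExp_abs_le hp fun y => ?_
            have := htaylor (T y - ξ i (y i)) (ξ i (y i)) (hb i (y i))
            rw [sub_add_cancel] at this
            have e : ξ i (y i) * f (T y) - ξ i (y i) * f (T y - ξ i (y i))
                - ξ i (y i) ^ 2 * f' (T y - ξ i (y i)) = ξ i (y i) *
                (f (T y) - f (T y - ξ i (y i)) - ξ i (y i) * f' (T y - ξ i (y i))) := by ring
            rw [e, abs_mul, ← sq_abs (ξ i (y i)), pow_two, mul_assoc]
            gcongr
        _ = v i * prodExp p (fun y => R (T y - ξ i (y i))) := d3
        _ ≤ v i * r := mul_le_mul_of_nonneg_left (hRi i) (hv0 i)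
    have e4 : ∀ i, |prodExp p (fun y => f' (T y - ξ i (y i)))
        - prodExp p (fun y => f' (T y))| ≤ r := by
      intro i
      rw [← prodExp_sub]
      refine (prodExp_abs_le hp fun y => ?_).trans (hRi i)
      have := hinc (T y - ξ i (y i)) (ξ i (y i)) (hb i (y i))
      rw [sub_add_cancel, abs_sub_comm] at this
      exact this
    rw [e1, e2, ← Finset.sum_sub_distrib]
    calc _ ≤ ∑ i, |prodExp p (fun y => ξ i (y i) * f (T y))
          - v i * prodExp p (fun y => f' (T y))| := Finset.abs_sum_le_sum_abs _ _
      _ ≤ ∑ i, v i * (2 * r) := by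
          refine Finset.sum_le_sum fun i _ => ?_
          have d1 : prodExp p (fun y => ξ i (y i) * f (T y))
              - v i * prodExp p (fun y => f' (T y)) =
              (prodExp p (fun y => ξ i (y i) * f (T y))
                - v i * prodExp p (fun y => f' (T y - ξ i (y i)))) +
              v i * (prodExp p (fun y => f' (T y - ξ i (y i)))
                - prodExp p (fun y => f' (T y))) := by ring
          rw [d1]
          refine (abs_add_le _ _).trans ?_
          rw [abs_mul, abs_of_nonneg (hv0 i)]
          have := mul_le_mul_of_nonneg_left (e4 i) (hv0 i)
          linarith [e3 i]
      _ = 2 * r := by rw [← Finset.sum_mul, hvar, one_mul]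
  have hEh : prodExp p (fun y => f' (T y)) =
      prodExp p (fun y => T y * f (T y)) + prodExp p (fun y => h (T y)) - m := by
    simp only [hstein]
    rw [prodExp_sub, prodExp_add, prodExp_const hp]
  have hfin : prodExp p (fun y => h (T y)) ≤
      prodExp p (fun y => if T y ≤ z + β then 1 else 0) := by
    refine prodExp_mono hp fun y => ?_
    split_ifs with g
    · exact h1 _
    · exact (hright _ (by linarith)).le
  have := (abs_le.1 hmain).2
  linarith

lemma stdPhi_eq (a : ℝ) :
    stdPhi a = ∫ x in Set.Iic a, gaussWeight x / Real.sqrt (2 * Real.pi) := rfl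

lemma hasDerivAt_stdPhi (a : ℝ) :
    HasDerivAt stdPhi (gaussWeight a / Real.sqrt (2 * Real.pi)) a :=
  hasDerivAt_integral_Iic (integrable_gaussWeight.div_const _)
    (continuous_gaussWeight.div_const _) a

lemma strictMono_stdPhi : StrictMono stdPhi :=
  strictMono_of_hasDerivAt_pos hasDerivAt_stdPhi fun a =>
    div_pos (gaussWeight_pos a) (by positivity)

lemma stdPhi_add_integral_Ioi (a : ℝ) :
    stdPhi a + ∫ x in Set.Ioi a, gaussWeight x / Real.sqrt (2 * Real.pi) = 1 := by
  have h := integral_add_compl (s := Set.Iic a) measurableSet_Iic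
    (integrable_gaussWeight.div_const (Real.sqrt (2 * Real.pi)))
  rw [Set.compl_Iic] at h
  rw [stdPhi_eq, h, integral_div, integral_gaussWeight, div_self (by positivity)]

lemma stdPhi_zero : stdPhi 0 = 1 / 2 := by
  have h1 := stdPhi_add_integral_Ioi 0
  have h2 := integral_comp_neg_Iic 0 (fun x => gaussWeight x / Real.sqrt (2 * Real.pi))
  have h3 : ∀ x, gaussWeight (-x) = gaussWeight x := fun x => by simp [gaussWeight]
  simp only [h3, neg_zero] at h2
  rw [← stdPhi_eq] at h2
  linarith

lemma one_sub_inv_le_stdPhi {a : ℝ} (ha : 0 < a) : 1 - 1 / a ≤ stdPhi a := by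
  have h1 := stdPhi_add_integral_Ioi a
  have hs : 1 ≤ Real.sqrt (2 * Real.pi) := by
    rw [Real.one_le_sqrt]; linarith [Real.pi_gt_three]
  have h2 : ∫ x in Set.Ioi a, gaussWeight x / Real.sqrt (2 * Real.pi) ≤
      ∫ x in Set.Ioi a, (1 / a) * (x * gaussWeight x) := by
    refine setIntegral_mono_on (integrable_gaussWeight.div_const _).integrableOn
      (integrable_mul_gaussWeight.const_mul _).integrableOn measurableSet_Ioi fun x hx => ?_
    have hx' : a < x := hx
    have hg := gaussWeight_pos x
    calc gaussWeight x / Real.sqrt (2 * Real.pi) ≤ gaussWeight x := div_le_self hg.le hs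
      _ ≤ (x / a) * gaussWeight x :=
          le_mul_of_one_le_left hg.le ((one_le_div ha).2 hx'.le)
      _ = _ := by ring
  rw [integral_const_mul, integral_Ioi_mul_gaussWeight] at h2
  have h3 : gaussWeight a ≤ 1 := Real.exp_le_one_iff.2 (by nlinarith [sq_nonneg a])
  have h4 : 1 / a * gaussWeight a ≤ 1 / a := mul_le_of_le_one_right (by positivity) h3
  linarith

lemma bddAbove_stdPhi_le {ε : ℝ} (hε : ε < 1) : BddAbove {a : ℝ | stdPhi a ≤ ε} := by
  refine ⟨2 / (1 - ε), fun a ha => ?_⟩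
  by_contra! h
  have h0 : 0 < 2 / (1 - ε) := div_pos two_pos (by linarith)
  have h1 := one_sub_inv_le_stdPhi h0
  have h2 := strictMono_stdPhi h
  have h3 : stdPhi a ≤ ε := ha
  rw [one_div_div] at h1
  linarith

lemma le_stdPhi_PhiInv {ε : ℝ} (hε : ε < 1) : ε ≤ stdPhi (PhiInv ε) := by
  by_contra! h
  have h1 : ∀ᶠ x in nhds (PhiInv ε), stdPhi x < ε :=
    (hasDerivAt_stdPhi (PhiInv ε)).continuousAt.eventually_lt_const h
  obtain ⟨δ, hδ, hb⟩ := Metric.eventually_nhds_iff.1 h1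
  have h2 : stdPhi (PhiInv ε + δ / 2) < ε := hb (by
    rw [Real.dist_eq, add_sub_cancel_left, abs_of_pos (by linarith)]; linarith)
  have h3 : PhiInv ε + δ / 2 ≤ PhiInv ε := le_csSup (bddAbove_stdPhi_le hε) h2.le
  linarith

lemma PhiInv_nonneg {ε : ℝ} (hε : 1 / 2 ≤ ε) (hε1 : ε < 1) : 0 ≤ PhiInv ε :=
  le_csSup (bddAbove_stdPhi_le hε1) (stdPhi_zero.trans_le hε)

lemma PhiInv_nonpos {ε : ℝ} (hε : ε < 1 / 2) : PhiInv ε ≤ 0 :=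
  Real.sSup_nonpos fun a ha => by
    by_contra! h
    have h1 := strictMono_stdPhi h
    have h2 : stdPhi a ≤ ε := ha
    rw [stdPhi_zero] at h1
    linarith

lemma exists_stdPhi_growth (a : ℝ) :
    ∃ c > 0, ∀ τ ∈ Set.Icc (0 : ℝ) 1, stdPhi a + c * τ ≤ stdPhi (a + τ) := by
  set M := Real.exp (-((|a| + 1) ^ 2) / 2) / Real.sqrt (2 * Real.pi) with hM
  refine ⟨M, by positivity, fun τ hτ => ?_⟩
  have h := (convex_Icc a (a + 1)).mul_sub_le_image_sub_of_le_deriv (f := stdPhi) (C := M)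
    (fun x _ => (hasDerivAt_stdPhi x).continuousAt.continuousWithinAt)
    (fun x _ => (hasDerivAt_stdPhi x).differentiableAt.differentiableWithinAt)
    (fun x hx => ?_) a ⟨le_rfl, by linarith⟩ (a + τ) ⟨by linarith [hτ.1], by linarith [hτ.2]⟩
    (by linarith [hτ.1])
  · rw [add_sub_cancel_left] at h
    linarith
  · rw [interior_Icc] at hx
    rw [(hasDerivAt_stdPhi x).deriv, gaussWeight, hM]
    have : x ^ 2 ≤ (|a| + 1) ^ 2 := by
      apply sq_le_sq'
      · linarith [hx.1, neg_abs_le a]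
      · linarith [hx.2, le_abs_self a]
    gcongr

/-- Quantile bound for sums of `n` bounded independent centred variables, uniform in the variance
and with a probability gain of order `1 / √n`. -/
lemma exists_quantile_bound {Y : Type*} [Fintype Y] {ε B : ℝ} (hε : ε ∈ Set.Ioo (0 : ℝ) 1)
    (hB : 0 < B) :
    ∃ K : ℝ, ∀ n : ℕ, 1 ≤ n → ∀ (p : Fin n → Y → ℝ) (ξ : Fin n → Y → ℝ),
      (∀ i, IsDist (p i)) → (∀ i, ∑ a, p i a * ξ i a = 0) → (∀ i a, |ξ i a| ≤ B) →
      ε + (1 - ε) / 2 / Real.sqrt n ≤ prodExp p (fun y =>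
        if ∑ i, ξ i (y i) ≤ Real.sqrt (∑ i, ∑ a, p i a * ξ i a ^ 2) * PhiInv ε + K
        then 1 else 0) := by
  obtain ⟨c, hc, hgrow⟩ := exists_stdPhi_growth (PhiInv ε)
  set a := PhiInv ε with ha
  have hε1 : 0 < 1 - ε := by linarith [hε.2]
  set K₁ := max B (29 * B / c) with hK₁
  have hK₁B : B ≤ K₁ := le_max_left _ _
  have hK₁c : 29 * B ≤ c * K₁ := by
    have : 29 * B / c ≤ K₁ := le_max_right _ _
    rw [div_le_iff₀ hc] at this
    linarith
  have hK₁0 : 0 < K₁ := hB.trans_le hK₁B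
  set t := K₁ * Real.sqrt (2 / (1 - ε)) with ht
  have ht0 : 0 < t := by positivity
  have ht2 : t ^ 2 = K₁ ^ 2 * (2 / (1 - ε)) := by
    rw [ht, mul_pow, Real.sq_sqrt (by positivity)]
  refine ⟨K₁ + B + t + K₁ * |a|, fun n hn p ξ hp hmean hb => ?_⟩
  set v := ∑ i, ∑ a, p i a * ξ i a ^ 2 with hv
  have hv0 : 0 ≤ v := Finset.sum_nonneg fun i _ => Finset.sum_nonneg fun a _ =>
    mul_nonneg ((hp i).1 a) (sq_nonneg _)
  set s := Real.sqrt v with hs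
  have hs0 : 0 ≤ s := Real.sqrt_nonneg _
  have hs2 : s ^ 2 = v := Real.sq_sqrt hv0
  have hn1 : (1 : ℝ) ≤ n := by exact_mod_cast hn
  have hsn : 1 ≤ Real.sqrt n := Real.one_le_sqrt.2 hn1
  have hmonoE : ∀ u, u ≤ s * a + (K₁ + B + t + K₁ * |a|) →
      prodExp p (fun y => if ∑ i, ξ i (y i) ≤ u then 1 else 0) ≤
      prodExp p (fun y => if ∑ i, ξ i (y i) ≤ s * a + (K₁ + B + t + K₁ * |a|) then 1 else 0) := by
    intro u hu
    refine prodExp_mono hp fun y => ?_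
    split_ifs with h1 h2
    · exact le_rfl
    · exact absurd (h1.trans hu) h2
    · norm_num
    · exact le_rfl
  rcases lt_or_ge s K₁ with hsK | hsK
  · have h1 := prodExp_sum_le_ge hp ξ hmean ht0
    have h2 : v / t ^ 2 ≤ (1 - ε) / 2 := by
      rw [ht2, div_le_iff₀ (by positivity), ← hs2]
      have : s ^ 2 ≤ K₁ ^ 2 := by gcongr
      calc s ^ 2 ≤ K₁ ^ 2 := this
        _ = _ := by field_simp
    have h3 : (1 - ε) / 2 / Real.sqrt n ≤ (1 - ε) / 2 := div_le_self (by positivity) hsn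
    have h4 : t ≤ s * a + (K₁ + B + t + K₁ * |a|) := by
      have : -(s * |a|) ≤ s * a := by
        rw [← mul_neg]; exact mul_le_mul_of_nonneg_left (neg_abs_le a) hs0
      have : s * |a| ≤ K₁ * |a| := by gcongr
      linarith
    have := hmonoE t h4
    linarith
  · have hspos : 0 < s := hK₁0.trans_le hsK
    have h1 := berry_esseen_prodExp hp (fun i y => ξ i y / s) (fun i => by
        simp only [← mul_div_assoc, ← Finset.sum_div, hmean, zero_div])
      (β := B / s) (by positivity) ((div_le_one hspos).2 (hK₁B.trans hsK))
      (fun i y => by rw [abs_div, abs_of_pos hspos]; gcongr; exact hb i y) (by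
        simp only [div_pow, ← mul_div_assoc, ← Finset.sum_div]
        rw [hs2, ← hv]
        exact div_self (by rw [← hs2]; positivity)) (a + K₁ / s)
    have h2 := hgrow (K₁ / s) ⟨by positivity, (div_le_one hspos).2 hsK⟩
    have h3 : ε ≤ stdPhi a := le_stdPhi_PhiInv hε.2
    have hsB : s ≤ B * Real.sqrt n := by
      have : v ≤ (B * Real.sqrt n) ^ 2 := by
        calc v ≤ ∑ i : Fin n, B ^ 2 := by
              refine Finset.sum_le_sum fun i _ => ?_
              calc ∑ a, p i a * ξ i a ^ 2 ≤ ∑ a, p i a * B ^ 2 := by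
                    refine Finset.sum_le_sum fun a _ => ?_
                    exact mul_le_mul_of_nonneg_left
                      (sq_le_sq' (abs_le.1 (hb i a)).1 (abs_le.1 (hb i a)).2) ((hp i).1 a)
                _ = B ^ 2 := by rw [← Finset.sum_mul, (hp i).2, one_mul]
          _ = _ := by
              rw [mul_pow, Real.sq_sqrt (by positivity)]
              simp
              ring
      exact Real.sqrt_le_iff.2 ⟨by positivity, this⟩
    have h4 : (1 - ε) / 2 / Real.sqrt n ≤ B / s := by
      rw [div_le_div_iff₀ (by positivity) hspos]
      nlinarith [hε.1]
    have h5 : 29 * (B / s) ≤ c * (K₁ / s) := by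
      rw [← mul_div_assoc, ← mul_div_assoc]; gcongr
    have h6 : ∀ y : Fin n → Y, (∑ i, ξ i (y i) / s ≤ a + K₁ / s + B / s) ↔
        ∑ i, ξ i (y i) ≤ s * a + (K₁ + B) := by
      intro y
      rw [← Finset.sum_div, div_le_iff₀ hspos]
      have : (a + K₁ / s + B / s) * s = s * a + (K₁ + B) := by field_simp; ring
      rw [this]
    simp only [h6] at h1
    have := hmonoE (s * a + (K₁ + B)) (by
      have : 0 ≤ K₁ * |a| := by positivity
      linarith)
    linarith

/-- A linear functional which is nonpositive on the nonnegative vectors annihilated by finitely many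
linear forms is, on nonnegative vectors, bounded by a multiple of the size of those forms. -/
lemma exists_le_mul_sum_abs {X κ : Type*} [Fintype X] [Fintype κ] (L : κ → X → ℝ) (f : X → ℝ)
    (h : ∀ P : X → ℝ, (∀ x, 0 ≤ P x) → (∀ k, ∑ x, L k x * P x = 0) → ∑ x, f x * P x ≤ 0) :
    ∃ K : ℝ, 0 ≤ K ∧ ∀ P : X → ℝ, (∀ x, 0 ≤ P x) →
      ∑ x, f x * P x ≤ K * ∑ k, |∑ x, L k x * P x| := by
  classical
  set A : (X → ℝ) →ₗ[ℝ] (κ → ℝ) := Matrix.mulVecLin (Matrix.of L) with hA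
  have hAv : ∀ P k, A P k = ∑ x, L k x * P x := fun P k => rfl
  set U : Finset X → Submodule ℝ (X → ℝ) := fun S =>
    { carrier := {P | ∀ x ∉ S, P x = 0}
      add_mem' := fun {P Q} hP hQ x hx => by simp [hP x hx, hQ x hx]
      zero_mem' := fun x _ => rfl
      smul_mem' := fun c P hP x hx => by simp [hP x hx] } with hU
  have hgood : ∀ S, ∃ K : ℝ, 0 ≤ K ∧ ((A.domRestrict (U S)).ker = ⊥ →
      ∀ P ∈ U S, ∑ x, f x * P x ≤ K * ∑ k, |∑ x, L k x * P x|) := by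
    intro S
    by_cases hS : (A.domRestrict (U S)).ker = ⊥
    · obtain ⟨K, -, hK⟩ := LinearMap.exists_antilipschitzWith _ hS
      refine ⟨(∑ x, |f x|) * K, by positivity, fun _ P hP => ?_⟩
      have h1 : ‖P‖ ≤ K * ‖A P‖ := by
        have := hK.le_mul_dist (⟨P, hP⟩ : U S) 0
        rw [map_zero, dist_zero_right, dist_zero_right] at this
        exact this
      have h2 : ‖A P‖ ≤ ∑ k, |∑ x, L k x * P x| := by
        rw [pi_norm_le_iff_of_nonneg (Finset.sum_nonneg fun _ _ => abs_nonneg _)]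
        intro k
        exact Finset.single_le_sum (f := fun k => |∑ x, L k x * P x|)
          (fun _ _ => abs_nonneg _) (Finset.mem_univ k)
      calc ∑ x, f x * P x ≤ ∑ x, |f x| * ‖P‖ := by
            refine Finset.sum_le_sum fun x _ => ?_
            calc f x * P x ≤ |f x| * |P x| := by rw [← abs_mul]; exact le_abs_self _
              _ ≤ _ := by gcongr; exact norm_le_pi_norm P x
        _ = (∑ x, |f x|) * ‖P‖ := by rw [Finset.sum_mul]
        _ ≤ (∑ x, |f x|) * (K * ∑ k, |∑ x, L k x * P x|) := by gcongr; exact h1.trans (by gcongr)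
        _ = _ := by ring
    · exact ⟨0, le_rfl, fun h => absurd h hS⟩
  choose K hK0 hK using hgood
  refine ⟨∑ S, K S, Finset.sum_nonneg fun S _ => hK0 S, ?_⟩
  have main : ∀ (N : ℕ) (P : X → ℝ), (∀ x, 0 ≤ P x) →
      (Finset.univ.filter (fun x => P x ≠ 0)).card ≤ N →
      ∑ x, f x * P x ≤ (∑ S, K S) * ∑ k, |∑ x, L k x * P x| := by
    intro N
    induction N with
    | zero =>
      intro P hP hN
      have hPz : ∀ x, P x = 0 := by
        intro x
        by_contra hx
        have : x ∈ Finset.univ.filter (fun x => P x ≠ 0) := by simpa using hx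
        have := Finset.card_pos.2 ⟨x, this⟩
        omega
      simp [hPz]
    | succ N ih =>
      intro P hP hN
      set S := Finset.univ.filter (fun x => P x ≠ 0) with hS
      have hmemS : ∀ x, x ∈ S ↔ P x ≠ 0 := fun x => by simp [hS]
      by_cases hker : (A.domRestrict (U S)).ker = ⊥
      · refine (hK S hker P fun x hx => ?_).trans ?_
        · by_contra hx0
          exact hx ((hmemS x).2 hx0)
        · gcongr
          exact Finset.single_le_sum (f := K) (fun S _ => hK0 S) (Finset.mem_univ S)
      · obtain ⟨z, hz, hz0⟩ := (Submodule.ne_bot_iff _).1 hker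
        have hzA : A (z : X → ℝ) = 0 := hz
        have hzne : (z : X → ℝ) ≠ 0 := fun h0 => hz0 (Subtype.ext h0)
        have hzS : ∀ x ∉ S, (z : X → ℝ) x = 0 := z.2
        obtain ⟨v, hvA, hvS, hvf, hvpos⟩ : ∃ v : X → ℝ, (∀ k, ∑ x, L k x * v x = 0) ∧
            (∀ x ∉ S, v x = 0) ∧ ∑ x, f x * v x ≤ 0 ∧ ∃ x, 0 < v x := by
          have hLz : ∀ k, ∑ x, L k x * (z : X → ℝ) x = 0 := fun k => by
            rw [← hAv, hzA]; rfl
          have hneg : ∀ g : X → ℝ, ∑ x, g x * (-(z : X → ℝ)) x = -∑ x, g x * (z : X → ℝ) x :=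
            fun g => by simp
          by_cases hp : ∃ x, 0 < (z : X → ℝ) x
          · by_cases hfz : ∑ x, f x * (z : X → ℝ) x ≤ 0
            · exact ⟨z, hLz, hzS, hfz, hp⟩
            · refine ⟨-z, fun k => by rw [hneg, hLz, neg_zero], fun x hx => by simp [hzS x hx],
                by rw [hneg]; linarith, ?_⟩
              by_contra! hn
              refine hfz (h z (fun x => ?_) hLz)
              have := hn x
              simp only [Pi.neg_apply] at this
              linarith
          · push Not at hp
            have hnn : ∀ x, 0 ≤ (-(z : X → ℝ)) x := fun x => by simpa using hp x
            have hL' : ∀ k, ∑ x, L k x * (-(z : X → ℝ)) x = 0 := fun k => by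
              rw [hneg, hLz, neg_zero]
            obtain ⟨x, hx⟩ := Function.ne_iff.1 hzne
            refine ⟨-z, hL', fun x hx => by simp [hzS x hx], h _ hnn hL', x, ?_⟩
            exact lt_of_le_of_ne (hnn x) (by simpa using hx)
        obtain ⟨x₁, hx₁⟩ := hvpos
        obtain ⟨x₀, hx₀, hmin⟩ := Finset.exists_min_image
          (Finset.univ.filter (fun x => 0 < v x)) (fun x => P x / v x) ⟨x₁, by simpa using hx₁⟩
        have hvx₀ : 0 < v x₀ := by simpa using hx₀
        set t := P x₀ / v x₀ with ht
        have ht0 : 0 ≤ t := div_nonneg (hP _) hvx₀.le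
        set P' : X → ℝ := fun x => P x - t * v x with hP'
        have hP'0 : ∀ x, 0 ≤ P' x := by
          intro x
          by_cases hvx : 0 < v x
          · have := hmin x (by simpa using hvx)
            rw [le_div_iff₀ hvx] at this
            simp only [hP']; linarith
          · have := mul_nonpos_of_nonneg_of_nonpos ht0 (not_lt.1 hvx)
            simp only [hP']; linarith [hP x]
        have hlin : ∀ g : X → ℝ, ∑ x, g x * P' x = ∑ x, g x * P x - t * ∑ x, g x * v x := by
          intro g
          rw [Finset.mul_sum, ← Finset.sum_sub_distrib]
          exact Finset.sum_congr rfl fun x _ => by simp only [hP']; ring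
        have hx₀S : x₀ ∈ S := by
          by_contra hx
          exact hvx₀.ne' (hvS x₀ hx)
        have hsub : Finset.univ.filter (fun x => P' x ≠ 0) ⊆ S.erase x₀ := by
          intro x hx
          have hx' : P' x ≠ 0 := by simpa using hx
          refine Finset.mem_erase.2 ⟨?_, ?_⟩
          · rintro rfl
            apply hx'
            simp only [hP', ht]
            field_simp
            ring
          · by_contra hxS
            apply hx'
            have : P x = 0 := by
              by_contra h0
              exact hxS ((hmemS x).2 h0)
            simp only [hP', hvS x hxS, this]
            ring
        have hcard := Finset.card_le_card hsub
        rw [Finset.card_erase_of_mem hx₀S] at hcard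
        have hfin := ih P' hP'0 (by omega)
        simp only [hlin, hvA, mul_zero, sub_zero] at hfin
        nlinarith
  exact fun P hP => main _ P hP le_rfl

/-- Moment generating function bound for a centred variable bounded by one. -/
lemma sum_mul_exp_le {Y : Type*} [Fintype Y] {q u : Y → ℝ} (hq : IsDist q)
    (h0 : ∑ a, q a * u a = 0) (hu : ∀ a, |u a| ≤ 1) (c : ℝ) :
    ∑ a, q a * Real.exp (c * u a) ≤ Real.exp (c ^ 2 / 2) := by
  have h1 : ∀ a, Real.exp (c * u a) ≤ Real.cosh c + u a * Real.sinh c := by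
    intro a
    have hua := abs_le.1 (hu a)
    have h := convexOn_exp.2 (Set.mem_univ c) (Set.mem_univ (-c))
      (show 0 ≤ (1 + u a) / 2 by linarith) (show 0 ≤ (1 - u a) / 2 by linarith) (by ring)
    simp only [smul_eq_mul] at h
    rw [Real.cosh_eq, Real.sinh_eq]
    calc Real.exp (c * u a) = Real.exp ((1 + u a) / 2 * c + (1 - u a) / 2 * -c) := by ring_nf
      _ ≤ _ := h
      _ = _ := by ring
  calc ∑ a, q a * Real.exp (c * u a)
      ≤ ∑ a, (q a * Real.cosh c + q a * u a * Real.sinh c) := by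
        refine Finset.sum_le_sum fun a _ => ?_
        have := mul_le_mul_of_nonneg_left (h1 a) (hq.1 a)
        linarith
    _ = Real.cosh c := by
        rw [Finset.sum_add_distrib, ← Finset.sum_mul, ← Finset.sum_mul, hq.2, h0]; ring
    _ ≤ _ := Real.cosh_le_exp_half_sq c

lemma integral_exp_mul_gaussWeight (θ : ℝ) :
    ∫ g, Real.exp (θ * g) * gaussWeight g = Real.exp (θ ^ 2 / 2) * Real.sqrt (2 * Real.pi) := by
  have h : ∀ g, Real.exp (θ * g) * gaussWeight g = Real.exp (θ ^ 2 / 2) * gaussWeight (g - θ) := by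
    intro g
    rw [gaussWeight, gaussWeight, ← Real.exp_add, ← Real.exp_add]
    ring_nf
  simp only [h]
  rw [integral_const_mul, integral_sub_right_eq_self gaussWeight θ, integral_gaussWeight]

lemma integrable_exp_mul_gaussWeight (θ : ℝ) :
    Integrable (fun g => Real.exp (θ * g) * gaussWeight g) := by
  by_contra h
  have := integral_undef h
  rw [integral_exp_mul_gaussWeight] at this
  have h2 : 0 < Real.exp (θ ^ 2 / 2) * Real.sqrt (2 * Real.pi) := by positivity
  linarith

/-- The squared normalized sum of bounded centred i.i.d. variables has a bounded exponential
moment. -/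
lemma prodExp_exp_sq_le {Y : Type*} [Fintype Y] {q u : Y → ℝ} (hq : IsDist q)
    (h0 : ∑ a, q a * u a = 0) (hu : ∀ a, |u a| ≤ 1) {n : ℕ} (hn : 1 ≤ n) :
    prodExp (fun _ : Fin n => q) (fun y => Real.exp ((∑ i, u (y i)) ^ 2 / (4 * n))) ≤ 2 := by
  have hn0 : (0 : ℝ) < n := by exact_mod_cast hn
  set r := Real.sqrt (1 / (2 * n)) with hr
  have hr2 : r ^ 2 = 1 / (2 * n) := Real.sq_sqrt (by positivity)
  have hsp : 0 < Real.sqrt (2 * Real.pi) := by positivity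
  have e1 : ∀ T : ℝ, Real.exp (T ^ 2 / (4 * n)) * Real.sqrt (2 * Real.pi) =
      ∫ g, Real.exp (r * T * g) * gaussWeight g := by
    intro T
    rw [integral_exp_mul_gaussWeight, mul_pow, hr2]
    congr 2
    field_simp
    ring
  have e2 : prodExp (fun _ : Fin n => q) (fun y => Real.exp ((∑ i, u (y i)) ^ 2 / (4 * n)))
      * Real.sqrt (2 * Real.pi) = ∫ g, prodExp (fun _ : Fin n => q)
        (fun y => Real.exp (r * (∑ i, u (y i)) * g) * gaussWeight g) := by
    simp only [prodExp]
    rw [integral_finsetSum _ fun y _ => (integrable_exp_mul_gaussWeight _).const_mul _,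
      Finset.sum_mul]
    refine Finset.sum_congr rfl fun y _ => ?_
    rw [integral_const_mul, ← e1, mul_assoc]
  have e3 : ∀ g, prodExp (fun _ : Fin n => q)
      (fun y => Real.exp (r * (∑ i, u (y i)) * g) * gaussWeight g) ≤
      Real.exp (-(1 / 4) * g ^ 2) := by
    intro g
    have e4 : ∀ y : Fin n → Y, Real.exp (r * (∑ i, u (y i)) * g) * gaussWeight g =
        gaussWeight g * ∏ i, Real.exp (r * g * u (y i)) := by
      intro y
      rw [← Real.exp_sum, ← Finset.mul_sum]
      ring_nf
    simp only [e4]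
    rw [prodExp_const_mul, prodExp_prod (fun _ a => Real.exp (r * g * u a))]
    have e5 : ∏ _i : Fin n, ∑ a, q a * Real.exp (r * g * u a) ≤
        ∏ _i : Fin n, Real.exp ((r * g) ^ 2 / 2) :=
      Finset.prod_le_prod
        (fun i _ => Finset.sum_nonneg fun a _ => mul_nonneg (hq.1 a) (Real.exp_pos _).le)
        fun i _ => sum_mul_exp_le hq h0 hu _
    calc _ ≤ gaussWeight g * ∏ _i : Fin n, Real.exp ((r * g) ^ 2 / 2) := by
          gcongr
          exact (gaussWeight_pos g).le
      _ = Real.exp (-(1 / 4) * g ^ 2) := by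
          rw [← Real.exp_sum, gaussWeight, ← Real.exp_add, mul_pow, hr2]
          congr 1
          simp
          field_simp
          ring
  have e6 : (∫ g, prodExp (fun _ : Fin n => q)
        (fun y => Real.exp (r * (∑ i, u (y i)) * g) * gaussWeight g)) ≤
      ∫ g, Real.exp (-(1 / 4) * g ^ 2) := by
    refine integral_mono ?_ (integrable_exp_neg_mul_sq (by norm_num)) e3
    simp only [prodExp]
    exact integrable_finsetSum _ fun y _ => (integrable_exp_mul_gaussWeight _).const_mul _
  rw [← e2, integral_gaussian] at e6
  have e7 : Real.sqrt (Real.pi / (1 / 4)) ≤ 2 * Real.sqrt (2 * Real.pi) := by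
    rw [Real.sqrt_le_left (by positivity), mul_pow, Real.sq_sqrt (by positivity)]
    linarith [Real.pi_pos]
  exact le_of_mul_le_mul_right (e6.trans e7) hsp

section Capacity

variable {X Y : Type*} [Fintype X] [Fintype Y] {W : X → Y → ℝ}

lemma isDist_outDist (hW : IsChannel W) {P : X → ℝ} (hP : IsDist P) : IsDist (outDist P W) := by
  refine ⟨fun y => Finset.sum_nonneg fun x _ => mul_nonneg (hP.1 x) ((hW x).1 y), ?_⟩
  simp only [outDist]
  rw [Finset.sum_comm]
  simp only [← Finset.mul_sum, (hW _).2, mul_one, hP.2]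

lemma outDist_ne_zero (hW : IsChannel W) {P : X → ℝ} (hP : IsDist P) {x : X} {y : Y}
    (hx : P x ≠ 0) (hy : W x y ≠ 0) : outDist P W y ≠ 0 := by
  have h1 : P x * W x y ≤ outDist P W y :=
    Finset.single_le_sum (f := fun x => P x * W x y)
      (fun x _ => mul_nonneg (hP.1 x) ((hW x).1 y)) (Finset.mem_univ x)
  have h2 : 0 < P x * W x y :=
    mul_pos (lt_of_le_of_ne (hP.1 x) hx.symm) (lt_of_le_of_ne ((hW x).1 y) hy.symm)
  linarith

lemma relEnt_eq_sub {p R : Y → ℝ} (hR : ∀ y, p y ≠ 0 → R y ≠ 0) :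
    relEnt p R = ∑ y, p y * Real.log (p y) - ∑ y, p y * Real.log (R y) := by
  rw [relEnt, ← Finset.sum_sub_distrib]
  refine Finset.sum_congr rfl fun y _ => ?_
  by_cases hy : p y = 0
  · simp [hy]
  · rw [Real.log_div hy (hR y hy)]; ring

lemma sum_mul_relEnt_eq {P : X → ℝ} {R : Y → ℝ}
    (hR : ∀ x y, P x ≠ 0 → W x y ≠ 0 → R y ≠ 0) :
    ∑ x, P x * relEnt (W x) R =
      ∑ x, P x * ∑ y, W x y * Real.log (W x y) - ∑ y, outDist P W y * Real.log (R y) := by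
  have h1 : ∀ x, P x * relEnt (W x) R = P x * ∑ y, W x y * Real.log (W x y)
      - ∑ y, P x * W x y * Real.log (R y) := by
    intro x
    by_cases hx : P x = 0
    · simp [hx]
    · rw [relEnt_eq_sub fun y => hR x y hx, mul_sub, Finset.mul_sum _ (fun y => W x y * _)]
      simp only [Finset.mul_sum, mul_assoc]
  simp only [h1, Finset.sum_sub_distrib, outDist, Finset.sum_mul]
  congr 1
  exact Finset.sum_comm

lemma mutInfo_eq_sub (hW : IsChannel W) {P : X → ℝ} (hP : IsDist P) :
    mutInfo P W = ∑ x, P x * ∑ y, W x y * Real.log (W x y)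
      - ∑ y, outDist P W y * Real.log (outDist P W y) :=
  sum_mul_relEnt_eq fun _ _ hx hy => outDist_ne_zero hW hP hx hy

/-- Gibbs' inequality. -/
lemma sum_mul_log_le {p q : Y → ℝ} (hp : IsDist p) (hq : IsDist q)
    (h : ∀ y, p y ≠ 0 → q y ≠ 0) :
    ∑ y, p y * Real.log (q y) ≤ ∑ y, p y * Real.log (p y) := by
  have h1 : ∀ y, p y * Real.log (q y) - p y * Real.log (p y) ≤ q y - p y := by
    intro y
    by_cases hy : p y = 0
    · simpa [hy] using hq.1 y
    · have hpy := lt_of_le_of_ne (hp.1 y) (Ne.symm hy)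
      have hqy := lt_of_le_of_ne (hq.1 y) (h y hy).symm
      have := Real.log_le_sub_one_of_pos (div_pos hqy hpy)
      rw [Real.log_div hqy.ne' hpy.ne'] at this
      calc _ = p y * (Real.log (q y) - Real.log (p y)) := by ring
        _ ≤ p y * (q y / p y - 1) := by gcongr
        _ = _ := by field_simp
  have h2 := Finset.sum_le_sum fun y (_ : y ∈ Finset.univ) => h1 y
  rw [Finset.sum_sub_distrib, Finset.sum_sub_distrib, hp.2, hq.2] at h2
  linarith

variable [Nonempty X]

/-- The capacity is attained. -/
lemma exists_isCAID (hW : IsChannel W) :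
    (∃ P, isCAID W P) ∧ ∀ P, IsDist P → mutInfo P W ≤ capacity W := by
  classical
  have hcont : ContinuousOn (fun P => mutInfo P W) (stdSimplex ℝ X) := by
    have h1 : Continuous (fun P : X → ℝ => ∑ x, P x * ∑ y, W x y * Real.log (W x y)
        - ∑ y, outDist P W y * Real.log (outDist P W y)) := by
      have h2 : ∀ y, Continuous (fun P : X → ℝ => outDist P W y) := fun y => by
        unfold outDist; fun_prop
      refine Continuous.sub (by fun_prop) (continuous_finsetSum _ fun y _ => ?_)
      exact Real.continuous_mul_log.comp (h2 y)
    exact h1.continuousOn.congr fun P hP => mutInfo_eq_sub hW hP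
  obtain ⟨P, hP, hmax⟩ := (isCompact_stdSimplex (𝕜 := ℝ) X).exists_isMaxOn
    ⟨_, single_mem_stdSimplex ℝ (Classical.arbitrary X)⟩ hcont
  have hg : IsGreatest {c : ℝ | ∃ P : X → ℝ, IsDist P ∧ c = mutInfo P W} (mutInfo P W) := by
    refine ⟨⟨P, hP, rfl⟩, ?_⟩
    rintro c ⟨P', hP', rfl⟩
    exact hmax hP'
  have hC : capacity W = mutInfo P W := hg.csSup_eq
  exact ⟨⟨P, hP, hC.symm⟩, fun P' hP' => hC ▸ hmax hP'⟩

/-- First-order optimality for mixtures of a capacity-achieving distribution with a point mass. -/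
lemma relEnt_mix_le_capacity (hW : IsChannel W) {P : X → ℝ} (hP : isCAID W P) (x : X) {t : ℝ}
    (ht : t ∈ Set.Ioo (0 : ℝ) 1) :
    ∑ y, W x y * Real.log (W x y)
      - ∑ y, W x y * Real.log ((1 - t) * outDist P W y + t * W x y) ≤ capacity W := by
  classical
  set D : X → ℝ := Pi.single x 1 with hD
  have hDsum : ∀ g : X → ℝ, ∑ x', D x' * g x' = g x := fun g => by
    simp [hD, Pi.single_apply]
  have hDd : IsDist D := ⟨fun x' => by
    simp only [hD, Pi.single_apply]; split_ifs <;> norm_num, by simp [hD]⟩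
  have hPd := hP.1
  have ht1 : 0 < 1 - t := by linarith [ht.2]
  set Pt : X → ℝ := fun x' => (1 - t) * P x' + t * D x' with hPt
  have hsum : ∀ g : X → ℝ, ∑ x', Pt x' * g x' = (1 - t) * ∑ x', P x' * g x' + t * g x := by
    intro g
    rw [← hDsum g, Finset.mul_sum, Finset.mul_sum, ← Finset.sum_add_distrib]
    exact Finset.sum_congr rfl fun x' _ => by simp only [hPt]; ring
  have hPtd : IsDist Pt := by
    refine ⟨fun x' => add_nonneg (mul_nonneg ht1.le (hPd.1 x'))
      (mul_nonneg ht.1.le (hDd.1 x')), ?_⟩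
    have := hsum (fun _ => 1)
    simp only [mul_one, hPd.2] at this
    linarith
  have hout : ∀ y, outDist Pt W y = (1 - t) * outDist P W y + t * W x y := fun y =>
    hsum (fun x' => W x' y)
  have hQd := isDist_outDist hW hPd
  have h1 := (exists_isCAID hW).2 Pt hPtd
  have h2 := mutInfo_eq_sub hW hPtd
  have h3 := mutInfo_eq_sub hW hPd
  rw [hP.2] at h3
  have h4 := sum_mul_log_le hQd (isDist_outDist hW hPtd) (fun y hy => by
    rw [hout]
    have a1 : 0 < (1 - t) * outDist P W y :=
      mul_pos ht1 (lt_of_le_of_ne (hQd.1 y) hy.symm)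
    have a2 := mul_nonneg ht.1.le ((hW x).1 y)
    linarith)
  rw [hsum] at h2
  have h5 : ∑ y, outDist Pt W y * Real.log (outDist Pt W y) =
      (1 - t) * ∑ y, outDist P W y * Real.log (outDist Pt W y)
        + t * ∑ y, W x y * Real.log (outDist Pt W y) := by
    rw [Finset.mul_sum, Finset.mul_sum, ← Finset.sum_add_distrib]
    exact Finset.sum_congr rfl fun y _ => by rw [hout]; ring
  simp only [← hout]
  have h6 := mul_le_mul_of_nonneg_left h4 ht1.le
  have h7 : t * (∑ y, W x y * Real.log (W x y) - ∑ y, W x y * Real.log (outDist Pt W y)) ≤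
      t * capacity W := by
    rw [h5] at h2
    nlinarith
  exact le_of_mul_le_mul_left h7 ht.1

lemma outDist_isCAID_dominates (hW : IsChannel W) {P : X → ℝ} (hP : isCAID W P) (x : X) (y : Y)
    (hy : outDist P W y = 0) : W x y = 0 := by
  classical
  by_contra hxy
  have hpos : 0 < W x y := lt_of_le_of_ne ((hW x).1 y) (Ne.symm hxy)
  have hQd := isDist_outDist hW hP.1
  have hle1 : ∀ {q : Y → ℝ}, IsDist q → ∀ z, q z ≤ 1 := fun {q} hq z => by
    rw [← hq.2]; exact Finset.single_le_sum (fun z _ => hq.1 z) (Finset.mem_univ z)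
  set H := ∑ y, W x y * Real.log (W x y)
  set N := (|H| + |capacity W| + 1) / W x y with hN
  have hN0 : 0 < N := by positivity
  have ht : Real.exp (-N) ∈ Set.Ioo (0 : ℝ) 1 :=
    ⟨Real.exp_pos _, Real.exp_lt_one_iff.2 (by linarith)⟩
  have h1 := relEnt_mix_le_capacity hW hP x ht
  set t := Real.exp (-N) with ht'
  have hterm : ∀ z, W x z * Real.log ((1 - t) * outDist P W z + t * W x z) ≤ 0 := by
    intro z
    refine mul_nonpos_of_nonneg_of_nonpos ((hW x).1 z) (Real.log_nonpos ?_ ?_)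
    · exact add_nonneg (mul_nonneg (by linarith [ht.2]) (hQd.1 z))
        (mul_nonneg ht.1.le ((hW x).1 z))
    · nlinarith [hle1 hQd z, hle1 (hW x) z, ht.1, ht.2]
  have h2 : ∑ z, W x z * Real.log ((1 - t) * outDist P W z + t * W x z) ≤
      W x y * Real.log ((1 - t) * outDist P W y + t * W x y) := by
    rw [← Finset.add_sum_erase _ _ (Finset.mem_univ y)]
    have := Finset.sum_nonpos fun z (_ : z ∈ Finset.univ.erase y) => hterm z
    linarith
  rw [hy, mul_zero, zero_add, Real.log_mul ht.1.ne' hpos.ne', ht', Real.log_exp] at h2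
  have h3 : Real.log (W x y) ≤ 0 := Real.log_nonpos hpos.le (hle1 (hW x) y)
  have h4 : W x y * N = |H| + |capacity W| + 1 := by rw [hN]; field_simp
  have h5 : W x y * (-N + Real.log (W x y)) ≤ -(|H| + |capacity W| + 1) := by nlinarith
  rw [← ht'] at h2
  linarith [neg_abs_le H, le_abs_self (capacity W)]

/-- Kuhn–Tucker condition for capacity-achieving distributions. -/
lemma relEnt_le_capacity (hW : IsChannel W) {P : X → ℝ} (hP : isCAID W P) (x : X) :
    relEnt (W x) (outDist P W) ≤ capacity W := by
  rw [relEnt_eq_sub fun y hy h0 => hy (outDist_isCAID_dominates hW hP x y h0)]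
  have hlim : Filter.Tendsto (fun t : ℝ => ∑ y, W x y * Real.log (W x y)
      - ∑ y, W x y * Real.log ((1 - t) * outDist P W y + t * W x y)) (nhdsWithin 0 (Set.Ioi 0))
      (nhds (∑ y, W x y * Real.log (W x y) - ∑ y, W x y * Real.log (outDist P W y))) := by
    refine Filter.Tendsto.mono_left ?_ nhdsWithin_le_nhds
    refine tendsto_const_nhds.sub (tendsto_finsetSum _ fun y _ => ?_)
    by_cases hy : W x y = 0
    · simp [hy]
    · refine tendsto_const_nhds.mul (Filter.Tendsto.log ?_
        fun h0 => hy (outDist_isCAID_dominates hW hP x y h0))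
      have : Continuous (fun t : ℝ => (1 - t) * outDist P W y + t * W x y) := by fun_prop
      simpa using this.tendsto 0
  refine le_of_tendsto hlim ?_
  filter_upwards [Ioo_mem_nhdsGT (zero_lt_one (α := ℝ))] with t ht
  exact relEnt_mix_le_capacity hW hP x ht

end Capacity

section Converse

/-- Meta-converse: if under every input the likelihood ratio with respect to `R` is at most
`exp θ` with probability at least `ε + δ`, then `δ * M* ≤ exp θ`. -/
lemma log_Mstar_le {A B : Type*} [Fintype B] [Nonempty A] [Nonempty B] {V : A → B → ℝ}
    (hV : ∀ a, IsDist (V a)) {ε : ℝ} (hε : 0 ≤ ε) {R : B → ℝ} (hR : ∀ b, 0 ≤ R b)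
    (hR1 : ∑ b, R b ≤ 1) {θ δ : ℝ} (hδ : 0 < δ)
    (h : ∀ a, ε + δ ≤ ∑ b, V a b * if V a b ≤ Real.exp θ * R b then 1 else 0) :
    Real.log (Mstar V ε) ≤ θ - Real.log δ := by
  set S := {M : ℕ | ∃ e : Fin M → A, ∃ d : B → Fin M, avgErr V e d ≤ ε}
  have hMpos : ∀ M ∈ S, 0 < M := fun M ⟨_, d, _⟩ => Fin.pos (d (Classical.arbitrary B))
  have hbound : ∀ M ∈ S, (M : ℝ) ≤ Real.exp θ / δ := by
    intro M hM
    have hM0 : (0 : ℝ) < M := by exact_mod_cast hMpos M hM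
    obtain ⟨e, d, hed⟩ := hM
    have hm : ∀ m, ∑ b ∈ Finset.univ.filter (fun b => d b = m), V (e m) b ≤
        (1 - ε - δ) + Real.exp θ * ∑ b ∈ Finset.univ.filter (fun b => d b = m), R b := by
      intro m
      have hpt : ∀ b, V (e m) b ≤ (V (e m) b - V (e m) b *
          if V (e m) b ≤ Real.exp θ * R b then 1 else 0) + Real.exp θ * R b := by
        intro b
        split_ifs with hb
        · linarith
        · linarith [mul_nonneg (Real.exp_pos θ).le (hR b)]
      have h1 := Finset.sum_le_sum fun b (_ : b ∈ Finset.univ.filter (fun b => d b = m)) => hpt b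
      rw [Finset.sum_add_distrib, ← Finset.mul_sum] at h1
      have h2 : ∑ b ∈ Finset.univ.filter (fun b => d b = m), (V (e m) b - V (e m) b *
          if V (e m) b ≤ Real.exp θ * R b then 1 else 0) ≤ ∑ b, (V (e m) b - V (e m) b *
          if V (e m) b ≤ Real.exp θ * R b then 1 else 0) := by
        refine Finset.sum_le_sum_of_subset_of_nonneg (Finset.filter_subset _ _) fun b _ _ => ?_
        split_ifs
        · simp
        · simpa using (hV (e m)).1 b
      conv_rhs at h2 => rw [Finset.sum_sub_distrib, (hV (e m)).2]
      linarith [h (e m)]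
    have h1 := Finset.sum_le_sum fun m (_ : m ∈ (Finset.univ : Finset (Fin M))) => hm m
    rw [Finset.sum_add_distrib, ← Finset.mul_sum, Finset.sum_fiberwise] at h1
    simp only [Finset.sum_const, Finset.card_univ, Fintype.card_fin, nsmul_eq_mul] at h1
    have h2 : Real.exp θ * ∑ b, R b ≤ Real.exp θ :=
      mul_le_of_le_one_right (Real.exp_pos θ).le hR1
    have h3 : (1 - ε) * M ≤
        ∑ m : Fin M, ∑ b ∈ Finset.univ.filter (fun b => d b = m), V (e m) b := by
      have h4 : 1 - ε ≤
          (∑ m : Fin M, ∑ b ∈ Finset.univ.filter (fun b => d b = m), V (e m) b) / M := by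
        rw [avgErr, one_div, inv_mul_eq_div] at hed
        linarith
      rwa [le_div_iff₀ hM0] at h4
    rw [le_div_iff₀ hδ]
    nlinarith
  have hne : S.Nonempty := by
    refine ⟨1, fun _ => Classical.arbitrary A, fun _ => 0, ?_⟩
    simp [avgErr, (hV _).2, hε]
  have hbdd : BddAbove S :=
    ⟨⌊Real.exp θ / δ⌋₊, fun M hM => Nat.le_floor (hbound M hM)⟩
  have hmem : Mstar V ε ∈ S := Nat.sSup_mem hne hbdd
  have h1 := Real.log_le_log (by exact_mod_cast hMpos _ hmem) (hbound _ hmem)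
  rwa [Real.log_div (Real.exp_pos θ).ne' hδ.ne', Real.log_exp] at h1

lemma sqrt_sub_sqrt_mul_le {s t φ B : ℝ} (hs : 0 ≤ s) (ht : 0 < t) (hB : 0 ≤ B)
    (h : (s - t) * φ ≤ B) : (√s - √t) * φ ≤ B / √t := by
  have ht' := Real.sqrt_pos.2 ht
  rw [le_div_iff₀ ht']
  rcases le_total ((√s - √t) * φ) 0 with h0 | h0
  · nlinarith
  · have h1 : (√s - √t) * φ * (√s + √t) = (s - t) * φ := by
      linear_combination φ * Real.sq_sqrt hs - φ * Real.sq_sqrt ht.le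
    nlinarith [mul_nonneg h0 (Real.sqrt_nonneg s)]

variable {X Y : Type*} [Fintype X] [Fintype Y]

lemma sum_tilted_prod_le_one [DecidableEq Y] [Nonempty Y] {Q : Y → ℝ} (hQ : IsDist Q) {n : ℕ}
    (hn : 1 ≤ n) :
    ∑ y : Fin n → Y, 1 / 2 * ((∏ i, Q (y i)) * Real.exp (1 / (4 * Fintype.card Y) / n *
      ∑ b, (∑ i, ((if y i = b then 1 else 0) - Q b)) ^ 2)) ≤ 1 := by
  have hQ1 : ∀ b, Q b ≤ 1 := fun b => by
    rw [← hQ.2]; exact Finset.single_le_sum (fun z _ => hQ.1 z) (Finset.mem_univ b)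
  have hc : (0 : ℝ) < Fintype.card Y := by exact_mod_cast Fintype.card_pos
  have hn0 : (0 : ℝ) < n := by exact_mod_cast hn
  have hb : ∀ b, prodExp (fun _ : Fin n => Q) (fun y => Real.exp
      ((∑ i, ((if y i = b then 1 else 0) - Q b)) ^ 2 / (4 * n))) ≤ 2 := by
    intro b
    refine prodExp_exp_sq_le (u := fun c => (if c = b then 1 else 0) - Q b) hQ ?_ ?_ hn
    · simp [mul_sub, Finset.sum_sub_distrib, ← Finset.sum_mul, hQ.2]
    · intro c
      have := hQ.1 b
      have := hQ1 b
      split_ifs <;> rw [abs_le] <;> constructor <;> linarith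
  have hconv : ∀ y : Fin n → Y, Real.exp (1 / (4 * Fintype.card Y) / n *
      ∑ b, (∑ i, ((if y i = b then 1 else 0) - Q b)) ^ 2) ≤
      ∑ b, (Fintype.card Y : ℝ)⁻¹ * Real.exp
        ((∑ i, ((if y i = b then 1 else 0) - Q b)) ^ 2 / (4 * n)) := by
    intro y
    have := convexOn_exp.map_sum_le (t := Finset.univ) (w := fun _ : Y => (Fintype.card Y : ℝ)⁻¹)
      (p := fun b => (∑ i, ((if y i = b then 1 else 0) - Q b)) ^ 2 / (4 * n))
      (fun _ _ => by positivity) (by simp [hc.ne']) (fun _ _ => Set.mem_univ _)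
    simp only [smul_eq_mul] at this
    refine le_trans (le_of_eq (congrArg Real.exp ?_)) this
    rw [Finset.mul_sum]
    refine Finset.sum_congr rfl fun b _ => ?_
    field_simp
  rw [← Finset.mul_sum]
  have h1 := prodExp_mono (fun _ : Fin n => hQ) hconv
  rw [prodExp_sum] at h1
  simp only [prodExp_const_mul] at h1
  have h2 := Finset.sum_le_sum fun b (_ : b ∈ (Finset.univ : Finset Y)) =>
    mul_le_mul_of_nonneg_left (hb b) (inv_nonneg.2 hc.le)
  simp only [Finset.sum_const, Finset.card_univ, nsmul_eq_mul] at h2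
  rw [mul_inv_cancel_left₀ hc.ne'] at h2
  have h3 := h1.trans h2
  unfold prodExp at h3
  linarith

lemma divVar_nonneg {p q : Y → ℝ} (hp : IsDist p) : 0 ≤ divVar p q :=
  Finset.sum_nonneg fun z _ => mul_nonneg (hp.1 z) (sq_nonneg _)

variable {W : X → Y → ℝ}

lemma infoVar_sub_Veps_mul_PhiInv_nonpos (hW : IsChannel W) {ε : ℝ}
    (hε : ε ∈ Set.Ioo (0 : ℝ) 1) (hV : 0 < Veps W ε) {P : X → ℝ} (hP : isCAID W P) :
    (infoVar P W - Veps W ε) * PhiInv ε ≤ 0 := by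
  unfold Veps at *
  split_ifs at * with h
  · refine mul_nonpos_of_nonneg_of_nonpos (sub_nonneg.2 (csInf_le ⟨0, ?_⟩ ⟨P, hP, rfl⟩))
      (PhiInv_nonpos h)
    rintro _ ⟨R, hR, rfl⟩
    exact Finset.sum_nonneg fun x _ => mul_nonneg (hR.1.1 x) (divVar_nonneg (hW x))
  · refine mul_nonpos_of_nonpos_of_nonneg (sub_nonpos.2 (le_csSup ?_ ⟨P, hP, rfl⟩))
      (PhiInv_nonneg (not_lt.1 h) hε.2)
    by_contra hb
    exact hV.ne' (Real.sSup_of_not_bddAbove hb)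

/-- The dispersion of an input distribution exceeds `V_ε`, in the unfavourable direction, by at
most a multiple of its distance to the capacity-achieving polytope. -/
lemma exists_dispersion_bound [Nonempty X] (hW : IsChannel W) {ε : ℝ}
    (hε : ε ∈ Set.Ioo (0 : ℝ) 1) (hV : 0 < Veps W ε) {R : X → ℝ} (hR : isCAID W R) :
    ∃ K, 0 ≤ K ∧ ∀ P : X → ℝ, IsDist P →
      (∑ x, P x * divVar (W x) (outDist R W) - Veps W ε) * PhiInv ε ≤
        K * (∑ x, P x * (capacity W - relEnt (W x) (outDist R W))
          + ∑ b, |outDist P W b - outDist R W b|) := by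
  set Q := outDist R W with hQ
  set a : X → ℝ := fun x => capacity W - relEnt (W x) Q with ha
  have ha0 : ∀ x, 0 ≤ a x := fun x => sub_nonneg.2 (relEnt_le_capacity hW hR x)
  have hsub : ∀ (P : X → ℝ) (b : Y), ∑ x, (W x b - Q b) * P x =
      outDist P W b - Q b * ∑ x, P x := by
    intro P b
    rw [outDist, Finset.mul_sum, ← Finset.sum_sub_distrib]
    exact Finset.sum_congr rfl fun x _ => by ring
  obtain ⟨K, hK0, hK⟩ := exists_le_mul_sum_abs (κ := Option Y)
    (fun k x => k.elim (a x) fun b => W x b - Q b)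
    (fun x => (divVar (W x) Q - Veps W ε) * PhiInv ε) (by
      intro P hP hk
      have hk0 : ∑ x, a x * P x = 0 := hk none
      have hkb : ∀ b, outDist P W b = Q b * ∑ x, P x := fun b => by
        have h1 : ∑ x, (W x b - Q b) * P x = 0 := hk (some b)
        rw [hsub] at h1
        linarith
      have hs0 : 0 ≤ ∑ x, P x := Finset.sum_nonneg fun x _ => hP x
      obtain ⟨s, hs⟩ : ∃ s, ∑ x, P x = s := ⟨_, rfl⟩
      simp only [hs] at hkb hs0
      rcases hs0.eq_or_lt with h0 | h0
      · have hP0 : ∀ x, P x = 0 := fun x =>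
          (Finset.sum_eq_zero_iff_of_nonneg fun x _ => hP x).1 (hs.trans h0.symm) x
            (Finset.mem_univ x)
        simp [hP0]
      · have hdist : IsDist (fun x => P x / s) :=
          ⟨fun x => div_nonneg (hP x) h0.le, by rw [← Finset.sum_div, hs, div_self h0.ne']⟩
        have hout : outDist (fun x => P x / s) W = Q := by
          funext b
          have : outDist (fun x => P x / s) W b = outDist P W b / s := by
            rw [outDist, outDist, Finset.sum_div]
            exact Finset.sum_congr rfl fun x _ => by ring
          rw [this, hkb, mul_div_assoc, div_self h0.ne', mul_one]
        have hcaid : isCAID W (fun x => P x / s) := by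
          refine ⟨hdist, ?_⟩
          have h1 : ∑ x, P x / s * a x = 0 := by
            rw [← mul_left_inj' h0.ne', zero_mul, ← hk0, Finset.sum_mul]
            exact Finset.sum_congr rfl fun x _ => by field_simp
          rw [mutInfo, hout]
          simp only [ha, mul_sub, Finset.sum_sub_distrib, ← Finset.sum_mul] at h1
          rw [hdist.2] at h1
          linarith
        have h1 := infoVar_sub_Veps_mul_PhiInv_nonpos hW hε hV hcaid
        rw [infoVar, hout] at h1
        have h2 : ∑ x, (divVar (W x) Q - Veps W ε) * PhiInv ε * P x =
            s * ((∑ x, P x / s * divVar (W x) Q - Veps W ε) * PhiInv ε) := by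
          have h3 : Veps W ε = ∑ x, P x / s * Veps W ε := by
            rw [← Finset.sum_mul, hdist.2, one_mul]
          conv_rhs => rw [h3]
          rw [← Finset.sum_sub_distrib, Finset.sum_mul, Finset.mul_sum]
          exact Finset.sum_congr rfl fun x _ => by field_simp
        rw [h2]
        exact mul_nonpos_of_nonneg_of_nonpos h0.le h1)
  refine ⟨K, hK0, fun P hP => ?_⟩
  have h1 := hK P hP.1
  rw [Fintype.sum_option] at h1
  simp only [Option.elim, hsub, hP.2, mul_one] at h1
  have h2 : ∑ x, a x * P x = ∑ x, P x * a x := Finset.sum_congr rfl fun x _ => mul_comm _ _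
  rw [h2, abs_of_nonneg (Finset.sum_nonneg fun x _ => mul_nonneg (hP.1 x) (ha0 x))] at h1
  refine le_trans (le_of_eq ?_) h1
  have h3 : Veps W ε = ∑ x, P x * Veps W ε := by
    rw [← Finset.sum_mul, hP.2, one_mul]
  conv_lhs => rw [h3]
  rw [← Finset.sum_sub_distrib, Finset.sum_mul]
  exact Finset.sum_congr rfl fun x _ => by ring

end Converse

section UniformBound

variable {X Y : Type*} [Fintype X] [Fintype Y]

lemma abs_sum_mul_le {p f : Y → ℝ} {M : ℝ} (hp : IsDist p) (hf : ∀ y, |f y| ≤ M) :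
    |∑ y, p y * f y| ≤ M := by
  calc |∑ y, p y * f y| ≤ ∑ y, p y * M := by
        refine (Finset.abs_sum_le_sum_abs _ _).trans (Finset.sum_le_sum fun y _ => ?_)
        rw [abs_mul, abs_of_nonneg (hp.1 y)]
        exact mul_le_mul_of_nonneg_left (hf y) (hp.1 y)
    _ = M := by rw [← Finset.sum_mul, hp.2, one_mul]

lemma abs_variance_sub_divVar_le {p q v : Y → ℝ} (hp : IsDist p) {γ Λ w : ℝ} (hγ : 0 ≤ γ)
    (hΛ : ∀ y, |Real.log (p y / q y)| ≤ Λ) (hv : ∀ y, |v y| ≤ w) (hv1 : ∀ y, |v y| ≤ 1) :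
    |∑ y, p y * (Real.log (p y / q y) - relEnt p q - 2 * γ * (v y - ∑ c, p c * v c)) ^ 2
      - divVar p q| ≤ 4 * γ * (4 * γ + 4 * Λ) * w := by
  have hD : |relEnt p q| ≤ Λ := abs_sum_mul_le hp hΛ
  have hm := abs_sum_mul_le hp hv
  have hm1 := abs_sum_mul_le hp hv1
  rw [divVar, ← Finset.sum_sub_distrib]
  simp only [← mul_sub]
  refine abs_sum_mul_le hp fun y => ?_
  generalize hB : v y - ∑ c, p c * v c = B
  generalize hA : Real.log (p y / q y) - relEnt p q = A
  have hBw : |B| ≤ 2 * w := by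
    rw [← hB]; exact (abs_sub _ _).trans (by linarith [hv y])
  have hB1 : |B| ≤ 2 := by
    rw [← hB]; exact (abs_sub _ _).trans (by linarith [hv1 y])
  have hA2 : |A| ≤ 2 * Λ := by
    rw [← hA]; exact (abs_sub _ _).trans (by linarith [hΛ y])
  have h1 : (A - 2 * γ * B) ^ 2 - A ^ 2 = (2 * γ * B) * (2 * γ * B - 2 * A) := by ring
  have h2 : |2 * γ * B| ≤ 4 * γ * w := by
    rw [abs_mul, abs_of_nonneg (by positivity)]; nlinarith
  have h3 : |2 * γ * B - 2 * A| ≤ 4 * γ + 4 * Λ := by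
    refine (abs_sub _ _).trans ?_
    rw [abs_mul (2 * γ), abs_mul 2 A, abs_of_nonneg (by positivity : 0 ≤ 2 * γ), abs_two]
    nlinarith
  rw [h1, abs_mul]
  calc _ ≤ 4 * γ * w * (4 * γ + 4 * Λ) :=
        mul_le_mul h2 h3 (abs_nonneg _) ((abs_nonneg _).trans h2)
    _ = _ := by ring

/-- Pointwise comparison of the output law of an input word with the tilted product law. -/
lemma prod_le_exp_mul_tilted [DecidableEq Y] {W : X → Y → ℝ} (hW : IsChannel W) {Q : Y → ℝ}
    (hQ : IsDist Q) (hdom : ∀ x y, Q y = 0 → W x y = 0) {γ : ℝ} (hγ : 0 ≤ γ) {n : ℕ}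
    (hn : 1 ≤ n) (xs : Fin n → X) {v : Y → ℝ} (hv : ∀ b, n * v b = ∑ i, W (xs i) b - n * Q b)
    (y : Fin n → Y) {t θ : ℝ}
    (ht : ∑ i, (Real.log (W (xs i) (y i) / Q (y i)) - relEnt (W (xs i)) Q
      - 2 * γ * (v (y i) - ∑ c, W (xs i) c * v c)) ≤ t)
    (hθ : t + ∑ i, relEnt (W (xs i)) Q - n * (γ * ∑ b, v b ^ 2) + Real.log 2 ≤ θ) :
    ∏ i, W (xs i) (y i) ≤ Real.exp θ * (1 / 2 * ((∏ i, Q (y i)) * Real.exp (γ / n *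
      ∑ b, (∑ i, ((if y i = b then 1 else 0) - Q b)) ^ 2))) := by
  have hn0 : (0 : ℝ) < n := by exact_mod_cast hn
  by_cases h0 : ∃ i, W (xs i) (y i) = 0
  · obtain ⟨i, hi⟩ := h0
    rw [Finset.prod_eq_zero (Finset.mem_univ i) hi]
    have := Finset.prod_nonneg fun i (_ : i ∈ Finset.univ) => hQ.1 (y i)
    positivity
  push Not at h0
  have hWpos : ∀ i, 0 < W (xs i) (y i) := fun i => lt_of_le_of_ne ((hW _).1 _) (h0 i).symm
  have hQpos : ∀ i, 0 < Q (y i) := fun i =>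
    lt_of_le_of_ne (hQ.1 _) fun h => h0 i (hdom _ _ h.symm)
  have hprod : ∏ i, W (xs i) (y i) =
      (∏ i, Q (y i)) * Real.exp (∑ i, Real.log (W (xs i) (y i) / Q (y i))) := by
    rw [Real.exp_sum, ← Finset.prod_mul_distrib]
    refine Finset.prod_congr rfl fun i _ => ?_
    rw [Real.exp_log (div_pos (hWpos i) (hQpos i)), mul_div_cancel₀ _ (hQpos i).ne']
  have hhalf : (1 / 2 : ℝ) = Real.exp (-Real.log 2) := by
    rw [Real.exp_neg, Real.exp_log two_pos, one_div]
  rw [hprod, hhalf]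
  rw [show ∀ a b c d : ℝ, a * (b * (c * d)) = c * (a * b * d) by intros; ring, ← Real.exp_add,
    ← Real.exp_add]
  refine mul_le_mul_of_nonneg_left (Real.exp_le_exp.2 ?_)
    (Finset.prod_nonneg fun i _ => (hQpos i).le)
  generalize hS : (fun b => ∑ i, ((if y i = b then 1 else 0) - Q b)) = S
  have hS' : ∀ b, ∑ i, ((if y i = b then 1 else 0) - Q b) = S b := fun b => congrFun hS b
  simp only [hS']
  have hsq : 2 * γ * ∑ b, v b * S b - n * (γ * ∑ b, v b ^ 2) ≤ γ / n * ∑ b, S b ^ 2 := by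
    simp only [Finset.mul_sum, ← Finset.sum_sub_distrib]
    refine Finset.sum_le_sum fun b _ => ?_
    have h1 : γ / n * S b ^ 2 - (2 * γ * (v b * S b) - n * (γ * v b ^ 2)) =
        γ / n * (S b - n * v b) ^ 2 := by field_simp; ring
    have h2 : 0 ≤ γ / n * (S b - n * v b) ^ 2 := by positivity
    linarith
  have hvS : ∑ b, v b * S b = ∑ i, v (y i) - n * ∑ b, Q b * v b := by
    simp only [← hS']
    simp only [Finset.sum_sub_distrib, mul_sub, Finset.sum_const, Finset.card_univ,
      Fintype.card_fin, nsmul_eq_mul, Finset.mul_sum]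
    congr 1
    · rw [Finset.sum_comm]
      simp
    · exact Finset.sum_congr rfl fun b _ => by ring
  have hWv : ∑ i, ∑ c, W (xs i) c * v c = n * ∑ b, Q b * v b + n * ∑ b, v b ^ 2 := by
    rw [Finset.sum_comm]
    simp only [← Finset.sum_mul]
    rw [Finset.mul_sum, Finset.mul_sum, ← Finset.sum_add_distrib]
    refine Finset.sum_congr rfl fun b _ => ?_
    rw [show ∑ i, W (xs i) b = n * v b + n * Q b by linarith [hv b]]
    ring
  simp only [Finset.sum_sub_distrib, ← Finset.mul_sum] at ht
  rw [hvS] at hsq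
  rw [hWv] at ht
  linarith

lemma mul_sqrt_sub_le {n : ℕ} {K A a : ℝ} (ha : 0 ≤ a) (haA : a ≤ A) :
    √n * (K * a) - n * a ≤ A * K ^ 2 / 4 := by
  have h1 : √(n : ℝ) * √n = n := Real.mul_self_sqrt (Nat.cast_nonneg n)
  have h2 : n * a = √n * √n * a := by rw [h1]
  nlinarith [mul_nonneg ha (sq_nonneg (√(n : ℝ) - K / 2)),
    mul_nonneg (sub_nonneg.2 haA) (sq_nonneg K)]

lemma mul_sqrt_sum_abs_sub_le {n : ℕ} {K γ : ℝ} (hγ : 0 < γ) (v : Y → ℝ) :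
    √n * (K * ∑ b, |v b|) - n * (γ * ∑ b, v b ^ 2) ≤ Fintype.card Y * (K ^ 2 / (4 * γ)) := by
  have h1 : √(n : ℝ) * √n = n := Real.mul_self_sqrt (Nat.cast_nonneg n)
  have h2 : ∀ b, √n * (K * |v b|) - n * (γ * v b ^ 2) ≤ K ^ 2 / (4 * γ) := by
    intro b
    have h0 : n * (γ * v b ^ 2) = √n * √n * (γ * |v b| ^ 2) := by rw [h1, sq_abs]
    have h3 : K ^ 2 / (4 * γ) - (√n * (K * |v b|) - √n * √n * (γ * |v b| ^ 2)) =
        γ * (√n * |v b| - K / (2 * γ)) ^ 2 := by field_simp; ring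
    have h4 : 0 ≤ γ * (√n * |v b| - K / (2 * γ)) ^ 2 := by positivity
    linarith
  have h3 := Finset.sum_le_sum fun b (_ : b ∈ (Finset.univ : Finset Y)) => h2 b
  simpa [Finset.sum_sub_distrib, Finset.mul_sum] using h3

/-- Uniformly over input words, the log-likelihood ratio with respect to the tilted
capacity-achieving output law has its `ε`-quantile at the second-order rate, up to a constant. -/
lemma exists_uniform_likelihood_bound [DecidableEq Y] [Nonempty X] [Nonempty Y] {W : X → Y → ℝ}
    (hW : IsChannel W) {ε : ℝ} (hε : ε ∈ Set.Ioo (0 : ℝ) 1) (hV : 0 < Veps W ε) {R : X → ℝ}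
    (hR : isCAID W R) :
    ∃ K, ∀ n : ℕ, 1 ≤ n → ∀ xs : Fin n → X, ε + (1 - ε) / 2 / √n ≤
      ∑ y : Fin n → Y, (∏ i, W (xs i) (y i)) * if ∏ i, W (xs i) (y i) ≤
        Real.exp (n * capacity W + √(n * Veps W ε) * PhiInv ε + K) *
          (1 / 2 * ((∏ i, outDist R W (y i)) * Real.exp (1 / (4 * Fintype.card Y) / n *
            ∑ b, (∑ i, ((if y i = b then 1 else 0) - outDist R W b)) ^ 2))) then 1 else 0 := by
  classical
  set Q := outDist R W
  set φ := PhiInv ε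
  have hQ : IsDist Q := isDist_outDist hW hR.1
  have hdom := outDist_isCAID_dominates hW hR
  set γ : ℝ := 1 / (4 * Fintype.card Y)
  have hcard : (0 : ℝ) < Fintype.card Y := by exact_mod_cast Fintype.card_pos
  have hγ : 0 < γ := by positivity
  set Λ : ℝ := ∑ x, ∑ y, |Real.log (W x y / Q y)|
  have hΛ : ∀ x y, |Real.log (W x y / Q y)| ≤ Λ := fun x y =>
    (Finset.single_le_sum (f := fun y => |Real.log (W x y / Q y)|) (fun _ _ => abs_nonneg _)
      (Finset.mem_univ y)).trans
    (Finset.single_le_sum (f := fun x => ∑ y, |Real.log (W x y / Q y)|)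
      (fun _ _ => Finset.sum_nonneg fun _ _ => abs_nonneg _) (Finset.mem_univ x))
  have hΛ0 : 0 ≤ Λ := Finset.sum_nonneg fun _ _ => Finset.sum_nonneg fun _ _ => abs_nonneg _
  set a : X → ℝ := fun x => capacity W - relEnt (W x) Q with hadef
  have ha0 : ∀ x, 0 ≤ a x := fun x => sub_nonneg.2 (relEnt_le_capacity hW hR x)
  have haA : ∀ x, a x ≤ ∑ x, a x := fun x =>
    Finset.single_le_sum (fun x _ => ha0 x) (Finset.mem_univ x)
  obtain ⟨Kd, hKd0, hKd⟩ := exists_dispersion_bound hW hε hV hR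
  obtain ⟨Kq, hKq⟩ := exists_quantile_bound (Y := Y) (B := 2 * Λ + 4 * γ) hε (by positivity)
  set Kv := 4 * γ * (4 * γ + 4 * Λ)
  have hKv0 : 0 ≤ Kv := by positivity
  set Ks := (Kd + Kv * |φ|) / √(Veps W ε) with hKs
  refine ⟨Kq + Real.log 2 + (∑ x, a x) * Ks ^ 2 / 4 + Fintype.card Y * (Ks ^ 2 / (4 * γ)),
    fun n hn xs => ?_⟩
  have hn0 : (0 : ℝ) < n := by exact_mod_cast hn
  set P : X → ℝ := fun x => (∑ i, if xs i = x then 1 else 0) / n with hPdef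
  have hPsum : ∀ h : X → ℝ, n * ∑ x, P x * h x = ∑ i, h (xs i) := by
    intro h
    have : ∀ x, n * (P x * h x) = ∑ i, if xs i = x then h x else 0 := by
      intro x
      simp only [hPdef]
      field_simp
      rw [Finset.sum_mul]
      exact Finset.sum_congr rfl fun i _ => by simp
    rw [Finset.mul_sum, Finset.sum_congr rfl fun x _ => this x, Finset.sum_comm]
    simp
  have hP : IsDist P := by
    refine ⟨fun x => ?_, ?_⟩
    · exact div_nonneg (Finset.sum_nonneg fun i _ => by split_ifs <;> simp) hn0.le
    · have := hPsum fun _ => 1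
      simp only [mul_one, Finset.sum_const, Finset.card_univ, Fintype.card_fin,
        nsmul_eq_mul] at this
      exact (mul_eq_left₀ hn0.ne').1 this
  set v : Y → ℝ := fun b => outDist P W b - Q b with hvdef
  have hv : ∀ b, n * v b = ∑ i, W (xs i) b - n * Q b := fun b => by
    rw [hvdef, mul_sub, outDist, hPsum fun x => W x b]
  have hle1 : ∀ {q : Y → ℝ}, IsDist q → ∀ z, q z ≤ 1 := fun {q} hq z => by
    rw [← hq.2]; exact Finset.single_le_sum (fun z _ => hq.1 z) (Finset.mem_univ z)
  have hPW := isDist_outDist hW hP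
  have hv1 : ∀ b, |v b| ≤ 1 := fun b => by
    rw [abs_le]
    constructor <;> linarith [hPW.1 b, hle1 hPW b, hQ.1 b, hle1 hQ b]
  have hvw : ∀ b, |v b| ≤ ∑ b, |v b| := fun b =>
    Finset.single_le_sum (f := fun b => |v b|) (fun _ _ => abs_nonneg _) (Finset.mem_univ b)
  set ξ : Fin n → Y → ℝ := fun i c => Real.log (W (xs i) c / Q c) - relEnt (W (xs i)) Q
      - 2 * γ * (v c - ∑ c, W (xs i) c * v c) with hξ
  have hξ0 : ∀ i, ∑ c, W (xs i) c * ξ i c = 0 := by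
    intro i
    simp only [hξ, mul_sub, Finset.sum_sub_distrib, ← Finset.sum_mul, (hW (xs i)).2]
    have : ∑ c, W (xs i) c * (2 * γ * v c) = 2 * γ * ∑ c, W (xs i) c * v c := by
      rw [Finset.mul_sum]; exact Finset.sum_congr rfl fun c _ => by ring
    rw [this, ← relEnt]
    ring
  have hξB : ∀ i c, |ξ i c| ≤ 2 * Λ + 4 * γ := by
    intro i c
    have h1 : |relEnt (W (xs i)) Q| ≤ Λ := abs_sum_mul_le (hW (xs i)) (hΛ (xs i))
    have h2 := abs_sum_mul_le (hW (xs i)) hv1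
    have h3 : |v c - ∑ c, W (xs i) c * v c| ≤ 2 := (abs_sub _ _).trans (by linarith [hv1 c])
    have h4 : |2 * γ * (v c - ∑ c, W (xs i) c * v c)| ≤ 4 * γ := by
      rw [abs_mul, abs_of_nonneg (by positivity : 0 ≤ 2 * γ)]; nlinarith
    calc |ξ i c| ≤ |Real.log (W (xs i) c / Q c)| + |relEnt (W (xs i)) Q|
          + |2 * γ * (v c - ∑ c, W (xs i) c * v c)| :=
          (abs_sub _ _).trans (add_le_add_left (abs_sub _ _) _)
      _ ≤ _ := by linarith [hΛ (xs i) c]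
  have hquant := hKq n hn (fun i => W (xs i)) ξ (fun i => hW (xs i)) hξ0 hξB
  set σ := ∑ i, ∑ c, W (xs i) c * ξ i c ^ 2 with hσ
  have hσ0 : 0 ≤ σ := Finset.sum_nonneg fun i _ => Finset.sum_nonneg fun c _ =>
    mul_nonneg ((hW _).1 c) (sq_nonneg _)
  have hvar : |σ - n * ∑ x, P x * divVar (W x) Q| ≤ n * (Kv * ∑ b, |v b|) := by
    rw [hPsum fun x => divVar (W x) Q, hσ, ← Finset.sum_sub_distrib]
    refine (Finset.abs_sum_le_sum_abs _ _).trans ?_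
    have h1 := Finset.sum_le_sum fun i (_ : i ∈ (Finset.univ : Finset (Fin n))) =>
      abs_variance_sub_divVar_le (hW (xs i)) hγ.le (hΛ (xs i)) hvw hv1
    simpa using h1
  set aP := ∑ x, P x * a x with haP
  have haP0 : 0 ≤ aP := Finset.sum_nonneg fun x _ => mul_nonneg (hP.1 x) (ha0 x)
  have haPA : aP ≤ ∑ x, a x := (le_abs_self _).trans <|
    abs_sum_mul_le hP fun x => by rw [abs_of_nonneg (ha0 x)]; exact haA x
  have hw0 : 0 ≤ ∑ b, |v b| := Finset.sum_nonneg fun _ _ => abs_nonneg _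
  have hdiff : (σ - n * Veps W ε) * φ ≤ n * ((Kd + Kv * |φ|) * (aP + ∑ b, |v b|)) := by
    have h1 := mul_le_mul_of_nonneg_left (hKd P hP) hn0.le
    have h2 : (σ - n * ∑ x, P x * divVar (W x) Q) * φ ≤ n * (Kv * ∑ b, |v b|) * |φ| :=
      (le_abs_self _).trans (by
        rw [abs_mul]; exact mul_le_mul_of_nonneg_right hvar (abs_nonneg _))
    have h3 : 0 ≤ n * (Kv * |φ| * aP) := by positivity
    calc (σ - n * Veps W ε) * φ = (σ - n * ∑ x, P x * divVar (W x) Q) * φ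
          + n * ((∑ x, P x * divVar (W x) Q - Veps W ε) * φ) := by ring
      _ ≤ n * (Kv * ∑ b, |v b|) * |φ| + n * (Kd * (aP + ∑ b, |v b|)) := add_le_add h2 h1
      _ ≤ _ := by linarith
  have hsqrt := sqrt_sub_sqrt_mul_le hσ0 (mul_pos hn0 hV) (by positivity) hdiff
  have hrate : n * ((Kd + Kv * |φ|) * (aP + ∑ b, |v b|)) / √(n * Veps W ε) =
      √n * (Ks * aP) + √n * (Ks * ∑ b, |v b|) := by
    have h1 : √(n : ℝ) * √n = n := Real.mul_self_sqrt hn0.le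
    have h2 := Real.sqrt_pos.2 hV
    have h3 := Real.sqrt_pos.2 hn0
    rw [Real.sqrt_mul hn0.le, hKs]
    nth_rewrite 1 [← h1]
    field_simp
  rw [hrate] at hsqrt
  have hb1 := mul_sqrt_sub_le (n := n) (K := Ks) haP0 haPA
  have hb2 := mul_sqrt_sum_abs_sub_le (n := n) (K := Ks) hγ v
  have hrel : ∑ i, relEnt (W (xs i)) Q = n * capacity W - n * aP := by
    rw [haP, hPsum a]
    simp [hadef]
  refine hquant.trans (Finset.sum_le_sum fun y _ => mul_le_mul_of_nonneg_left ?_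
    (Finset.prod_nonneg fun i _ => (hW _).1 _))
  beta_reduce
  by_cases hy : ∑ i, ξ i (y i) ≤ √σ * PhiInv ε + Kq
  · rw [if_pos hy, if_pos]
    refine prod_le_exp_mul_tilted hW hQ hdom hγ.le hn xs hv y hy ?_
    rw [hrel]
    linarith
  · rw [if_neg hy]
    split_ifs <;> simp

end UniformBound

/-- For a DMC `W` and `ε ∈ (0,1)` with positive `ε`-dispersion, the
`ε`-error capacity satisfies
`log M*(Wⁿ, ε) ≤ n C + √(n V_ε) Φ⁻¹(ε) + (1/2) log n + K` for some constant `K`. -/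
theorem third_order_converse_positive_dispersion
    {X Y : Type*} [Fintype X] [Fintype Y] [Nonempty X] [Nonempty Y]
    (W : X → Y → ℝ) (hW : IsChannel W) (ε : ℝ) (hε : ε ∈ Set.Ioo (0 : ℝ) 1)
    (hV : 0 < Veps W ε) :
    ∃ K : ℝ, ∀ n : ℕ, 1 ≤ n →
      Real.log (Mstar (fun (xs : Fin n → X) (ys : Fin n → Y) => ∏ i, W (xs i) (ys i)) ε) ≤
        (n : ℝ) * capacity W + Real.sqrt ((n : ℝ) * Veps W ε) * PhiInv ε
          + (1 / 2) * Real.log n + K := by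
  classical
  obtain ⟨⟨R, hR⟩, -⟩ := exists_isCAID hW
  have hQ := isDist_outDist hW hR.1
  obtain ⟨K, hK⟩ := exists_uniform_likelihood_bound hW hε hV hR
  refine ⟨K - Real.log ((1 - ε) / 2), fun n hn => ?_⟩
  have hn0 : (0 : ℝ) < n := by exact_mod_cast hn
  have hε1 : 0 < (1 - ε) / 2 := by linarith [hε.2]
  have hdist : ∀ xs : Fin n → X, IsDist fun ys : Fin n → Y => ∏ i, W (xs i) (ys i) := by
    intro xs
    refine ⟨fun y => Finset.prod_nonneg fun i _ => (hW _).1 _, ?_⟩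
    simpa [prodExp] using prodExp_const (p := fun i => W (xs i)) (fun i => hW (xs i)) 1
  have h1 := log_Mstar_le hdist hε.1.le
    (fun y => by
      have := Finset.prod_nonneg fun i (_ : i ∈ (Finset.univ : Finset (Fin n))) => hQ.1 (y i)
      positivity)
    (sum_tilted_prod_le_one hQ hn) (div_pos hε1 (Real.sqrt_pos.2 hn0)) (hK n hn)
  rw [Real.log_div hε1.ne' (Real.sqrt_pos.2 hn0).ne', Real.log_sqrt hn0.le] at h1
  linarith
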